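/- arXiv:2211.10349 — 5 statements merged into one kernel-verified Lean document; each statement's English description precedes it below -/
import Mathlib

section
/- Let n, m ∈ ℕ and let f : ℝ^n × ℝ^m → ℂ be a function. The following are equivalent: (a) for every g ∈ 𝓢(ℝ^m) the function (x,y) ↦ f(x,y)·g(y) belongs to 𝓢(ℝ^{n+m}); (b) f is smooth and for all k, l ∈ ℕ there exists r ∈ ℕ such that sup over (x,y) ∈ ℝ^n × ℝ^m and multi-indices a with |a| ≤ k of (1+‖x‖)^l · (1+‖y‖)^{−r} · |∂^a f(x,y)| is finite. Moreover, if these hold, then the linear map M_f : 𝓢(ℝ^m) → 𝓢(ℝ^{n+m}), M_f(g)(x,y) = f(x,y)·g(y), is continuous. -/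
noncomputable section

/-- `ℝ^d`. -/
abbrev Euc (d : ℕ) : Type := EuclideanSpace ℝ (Fin d)

open Filter Topology
open scoped SchwartzMap ContDiff

section MixedSchwartzMultiplier

variable {E F : Type*} [NormedAddCommGroup E] [NormedSpace ℝ E]
  [NormedAddCommGroup F] [NormedSpace ℝ F]

/-- A Schwartz function and its derivatives up to order `k` decay faster than `(1 + ‖x‖) ^ (-l)`,
uniformly in the order of the derivative. -/
lemma SchwartzMap.exists_one_add_pow_mul_le (g : 𝓢(E, ℂ)) (k l : ℕ) :
    ∃ C : ℝ, ∀ (x : E) (i : ℕ), i ≤ k →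
      (1 + ‖x‖) ^ l * ‖iteratedFDeriv ℝ i g x‖ ≤ C :=
  ⟨_, fun x _ hi =>
    SchwartzMap.one_add_le_sup_seminorm_apply (𝕜 := ℂ) (m := (l, k)) le_rfl hi g x⟩

/-- A rapidly convergent superposition of translates of a Schwartz function is Schwartz. -/
lemma SchwartzMap.exists_eq_tsum_translates (φ : 𝓢(E, ℂ)) (c : ℕ → ℝ) (y : ℕ → E)
    (hc : ∀ j, 0 ≤ c j) (hs : ∀ a : ℕ, Summable fun j => c j * (1 + ‖y j‖) ^ a) :
    ∃ g : 𝓢(E, ℂ), ∀ x, g x = ∑' j, c j • φ (x - y j) := by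
  choose K hK using fun k l => φ.exists_one_add_pow_mul_le k l
  have hsm : ∀ j, ContDiff ℝ ∞ fun x => c j • φ (x - y j) := fun j =>
    ((φ.smooth ⊤).comp (contDiff_id.sub contDiff_const)).const_smul (c j)
  have hD : ∀ (k j : ℕ) (x : E), iteratedFDeriv ℝ k (fun x => c j • φ (x - y j)) x =
      c j • iteratedFDeriv ℝ k φ (x - y j) := fun k j x => by
    rw [← iteratedFDeriv_comp_sub]
    refine iteratedFDeriv_const_smul_apply' (ContDiff.contDiffAt ?_)
    exact ((φ.smooth k).comp (contDiff_id.sub contDiff_const))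
  have hbd : ∀ (a k j : ℕ) (x : E),
      (1 + ‖x‖) ^ a * ‖iteratedFDeriv ℝ k (fun x => c j • φ (x - y j)) x‖ ≤
        K k a * (c j * (1 + ‖y j‖) ^ a) := fun a k j x => by
    have h1 : (1 + ‖x‖) ≤ (1 + ‖x - y j‖) * (1 + ‖y j‖) := by
      have := norm_add_le (x - y j) (y j)
      rw [sub_add_cancel] at this
      nlinarith [norm_nonneg (x - y j), norm_nonneg (y j)]
    have hcj := hc j
    rw [hD, norm_smul, Real.norm_of_nonneg (hc j)]
    calc (1 + ‖x‖) ^ a * (c j * ‖iteratedFDeriv ℝ k φ (x - y j)‖)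
        ≤ ((1 + ‖x - y j‖) * (1 + ‖y j‖)) ^ a * (c j * ‖iteratedFDeriv ℝ k φ (x - y j)‖) := by
          gcongr
      _ = ((1 + ‖x - y j‖) ^ a * ‖iteratedFDeriv ℝ k φ (x - y j)‖) *
            (c j * (1 + ‖y j‖) ^ a) := by rw [mul_pow]; ring
      _ ≤ K k a * (c j * (1 + ‖y j‖) ^ a) := by
          gcongr
          exact hK k a _ k le_rfl
  have hv : ∀ k : ℕ, (k : ℕ∞) ≤ ⊤ → Summable fun j => K k 0 * (c j * (1 + ‖y j‖) ^ 0) :=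
    fun k _ => (hs 0).mul_left _
  have hbd0 : ∀ (k j : ℕ) (x : E), (k : ℕ∞) ≤ ⊤ →
      ‖iteratedFDeriv ℝ k (fun x => c j • φ (x - y j)) x‖ ≤
        K k 0 * (c j * (1 + ‖y j‖) ^ 0) := fun k j x _ => by
    simpa using hbd 0 k j x
  refine ⟨⟨fun x => ∑' j, c j • φ (x - y j), contDiff_tsum hsm hv hbd0, fun a k => ?_⟩,
    fun x => rfl⟩
  refine ⟨∑' j, K k a * (c j * (1 + ‖y j‖) ^ a), fun x => ?_⟩
  have hsum : Summable fun j => ‖iteratedFDeriv ℝ k (fun x => c j • φ (x - y j)) x‖ :=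
    (hv k le_top).of_nonneg_of_le (fun _ => norm_nonneg _) fun j => hbd0 k j x le_top
  rw [iteratedFDeriv_tsum_apply hsm hv hbd0 le_top]
  calc ‖x‖ ^ a * ‖∑' j, iteratedFDeriv ℝ k (fun x => c j • φ (x - y j)) x‖
      ≤ (1 + ‖x‖) ^ a * ∑' j, ‖iteratedFDeriv ℝ k (fun x => c j • φ (x - y j)) x‖ := by
        gcongr
        · linarith
        · exact norm_tsum_le_tsum_norm hsum
    _ = ∑' j, (1 + ‖x‖) ^ a * ‖iteratedFDeriv ℝ k (fun x => c j • φ (x - y j)) x‖ :=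
        tsum_mul_left.symm
    _ ≤ _ := (hsum.mul_left _).tsum_le_tsum (fun j => hbd a k j x) ((hs a).mul_left _)

/-- Composition with the second projection does not increase the norm of derivatives. -/
lemma norm_iteratedFDeriv_comp_snd_le {g : F → ℂ} (hg : ContDiff ℝ ∞ g) (i : ℕ) (p : E × F) :
    ‖iteratedFDeriv ℝ i (fun q : E × F => g q.2) p‖ ≤ ‖iteratedFDeriv ℝ i g p.2‖ := by
  have h := (ContinuousLinearMap.snd ℝ E F).iteratedFDeriv_comp_right hg p (i := i)
    (mod_cast le_top)
  change ‖iteratedFDeriv ℝ i (g ∘ ContinuousLinearMap.snd ℝ E F) p‖ ≤ _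
  rw [h]
  refine (ContinuousMultilinearMap.norm_compContinuousLinearMap_le _ _).trans ?_
  refine mul_le_of_le_one_right (norm_nonneg _) (Finset.prod_le_one (fun _ _ => norm_nonneg _) ?_)
  exact fun _ _ => ContinuousLinearMap.norm_snd_le ℝ E F

/-- Multiplication by an element of the mixed Schwartz–multiplier space is a continuous linear map
between Schwartz spaces. -/
lemma exists_schwartz_mulCLM {f : E × F → ℂ} (hf : ContDiff ℝ ∞ f)
    (hb : ∀ k l : ℕ, ∃ r : ℕ, ∃ C : ℝ, ∀ (p : E × F) (i : ℕ), i ≤ k →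
      (1 + ‖p.1‖) ^ l * (1 + ‖p.2‖) ^ (-(r : ℤ)) * ‖iteratedFDeriv ℝ i f p‖ ≤ C) :
    ∃ M : 𝓢(F, ℂ) →L[ℂ] 𝓢(E × F, ℂ), ∀ (g : 𝓢(F, ℂ)) (x : E) (y : F),
      M g (x, y) = f (x, y) * g y := by
  have hgs : ∀ g : 𝓢(F, ℂ), ContDiff ℝ ∞ fun p : E × F => g p.2 := fun g =>
    (g.smooth ⊤).comp contDiff_snd
  refine ⟨SchwartzMap.mkCLM (σ := RingHom.id ℂ) (fun g p => f p * g p.2)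
    (fun g h p => by simp [mul_add]) (fun a g p => by simp [mul_left_comm])
    (fun g => hf.mul (hgs g)) ?_, fun g x y => rfl⟩
  rintro ⟨l, k⟩
  obtain ⟨r, C, hC⟩ := hb k l
  have hC0 : 0 ≤ C := le_trans (by positivity) (hC 0 0 (Nat.zero_le _))
  refine ⟨Finset.Iic (l + r, k), ∑ i ∈ Finset.range (k + 1), (k.choose i : ℝ) * C * 2 ^ (l + r),
    by positivity, fun g p => ?_⟩
  dsimp only
  set S := ((Finset.Iic (l + r, k)).sup (schwartzSeminormFamily ℂ F ℂ)) g
  have hp : ‖p‖ ≤ (1 + ‖p.1‖) * (1 + ‖p.2‖) := by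
    rw [Prod.norm_def]
    refine max_le ?_ ?_ <;> nlinarith [norm_nonneg p.1, norm_nonneg p.2]
  have hy : (0 : ℝ) < 1 + ‖p.2‖ := by positivity
  rw [Finset.sum_mul]
  calc ‖p‖ ^ l * ‖iteratedFDeriv ℝ k (fun p => f p * g p.2) p‖
      ≤ ((1 + ‖p.1‖) * (1 + ‖p.2‖)) ^ l * ∑ i ∈ Finset.range (k + 1), (k.choose i : ℝ) *
          ‖iteratedFDeriv ℝ i f p‖ * ‖iteratedFDeriv ℝ (k - i) (fun p : E × F => g p.2) p‖ := by
        gcongr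
        exact norm_iteratedFDeriv_mul_le hf (hgs g) p (mod_cast le_top)
    _ = ∑ i ∈ Finset.range (k + 1), ((1 + ‖p.1‖) * (1 + ‖p.2‖)) ^ l * ((k.choose i : ℝ) *
          ‖iteratedFDeriv ℝ i f p‖ * ‖iteratedFDeriv ℝ (k - i) (fun p : E × F => g p.2) p‖) :=
        Finset.mul_sum _ _ _
    _ ≤ _ := by
        refine Finset.sum_le_sum fun i hi => ?_
        have hi' : i ≤ k := Nat.lt_succ_iff.mp (Finset.mem_range.mp hi)
        have h1 := hC p i hi'
        have h2 : (1 + ‖p.2‖) ^ (l + r) * ‖iteratedFDeriv ℝ (k - i) g p.2‖ ≤ 2 ^ (l + r) * S :=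
          SchwartzMap.one_add_le_sup_seminorm_apply (𝕜 := ℂ) (m := (l + r, k)) le_rfl
            (Nat.sub_le _ _) g p.2
        have h3 := norm_iteratedFDeriv_comp_snd_le (E := E) (g.smooth ⊤) (k - i) p
        calc ((1 + ‖p.1‖) * (1 + ‖p.2‖)) ^ l * ((k.choose i : ℝ) * ‖iteratedFDeriv ℝ i f p‖ *
              ‖iteratedFDeriv ℝ (k - i) (fun p : E × F => g p.2) p‖)
            ≤ ((1 + ‖p.1‖) * (1 + ‖p.2‖)) ^ l * ((k.choose i : ℝ) * ‖iteratedFDeriv ℝ i f p‖ *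
              ‖iteratedFDeriv ℝ (k - i) g p.2‖) := by gcongr
          _ = (k.choose i : ℝ) *
              ((1 + ‖p.1‖) ^ l * (1 + ‖p.2‖) ^ (-(r : ℤ)) * ‖iteratedFDeriv ℝ i f p‖) *
              ((1 + ‖p.2‖) ^ (l + r) * ‖iteratedFDeriv ℝ (k - i) g p.2‖) := by
              rw [zpow_neg, zpow_natCast, pow_add, mul_pow]
              field_simp
          _ ≤ (k.choose i : ℝ) * C * (2 ^ (l + r) * S) := by gcongr
          _ = (k.choose i : ℝ) * C * 2 ^ (l + r) * S := by ring

/-- Where `g` is locally constant, the derivatives of `f * g` are multiples of those of `f`. -/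
lemma norm_iteratedFDeriv_of_eventuallyEq_const {f w : E × F → ℂ} {g : F → ℂ} {c : ℂ} {p : E × F}
    (hf : ContDiffAt ℝ ∞ f p) (hw : ∀ q, w q = f q * g q.2) (hg : ∀ᶠ y in 𝓝 p.2, g y = c)
    (i : ℕ) : ‖iteratedFDeriv ℝ i w p‖ = ‖c‖ * ‖iteratedFDeriv ℝ i f p‖ := by
  have h : w =ᶠ[𝓝 p] c • f := by
    filter_upwards [continuous_snd.continuousAt.eventually hg] with q hq
    rw [hw, hq, Pi.smul_apply, smul_eq_mul, mul_comm]
  rw [(h.iteratedFDeriv ℝ i).eq_of_nhds,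
    iteratedFDeriv_const_smul_apply (hf.of_le (mod_cast le_top)), norm_smul]

end MixedSchwartzMultiplier

section Necessity

variable {E F : Type*} [NormedAddCommGroup E] [NormedSpace ℝ E]
  [NormedAddCommGroup F] [InnerProductSpace ℝ F] [FiniteDimensional ℝ F]

/-- A Schwartz function equal to `1` on the ball of radius `R` and supported in the ball of radius
`R + 1`. -/
lemma SchwartzMap.exists_bump {R : ℝ} (hR : 0 < R) :
    ∃ φ : 𝓢(F, ℂ), (∀ y, ‖y‖ ≤ R → φ y = 1) ∧ ∀ y, R + 1 ≤ ‖y‖ → φ y = 0 := by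
  let b : ContDiffBump (0 : F) := ⟨R, R + 1, hR, by linarith⟩
  have hs : HasCompactSupport fun y => ((b y : ℝ) : ℂ) :=
    b.hasCompactSupport.comp_left (g := Complex.ofReal) rfl
  have hd : ContDiff ℝ ∞ fun y => ((b y : ℝ) : ℂ) := Complex.ofRealCLM.contDiff.comp b.contDiff
  refine ⟨hs.toSchwartzMap hd, fun y hy => ?_,
    fun y hy => ?_⟩
  · have : b y = 1 := b.one_of_mem_closedBall (by simpa using hy)
    change ((b y : ℝ) : ℂ) = 1
    simp [this]
  · have : b y = 0 := b.zero_of_le_dist (by simpa using hy)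
    change ((b y : ℝ) : ℂ) = 0
    simp [this]

variable {f : E × F → ℂ}

/-- If all products `f * g` with `g` Schwartz are Schwartz, then `f` is smooth. -/
lemma contDiff_of_forall_mul_schwartz
    (h : ∀ g : 𝓢(F, ℂ), ∃ w : 𝓢(E × F, ℂ), ∀ x y, w (x, y) = f (x, y) * g y) :
    ContDiff ℝ ∞ f := by
  refine contDiff_iff_contDiffAt.2 fun p => ?_
  obtain ⟨φ, hφ, -⟩ := SchwartzMap.exists_bump (F := F) (R := ‖p.2‖ + 1) (by positivity)
  obtain ⟨w, hw⟩ := h φ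
  refine (w.smooth ⊤).contDiffAt.congr_of_eventuallyEq ?_
  have : ∀ᶠ y in 𝓝 p.2, ‖y‖ < ‖p.2‖ + 1 :=
    continuous_norm.continuousAt.eventually (gt_mem_nhds (lt_add_one _))
  filter_upwards [continuous_snd.continuousAt.eventually this] with q hq
  rw [hw q.1 q.2, hφ _ hq.le, mul_one]

/-- If all products `f * g` with `g` Schwartz are Schwartz, then `f` decays rapidly in the first
variable, uniformly for bounded second variable. -/
lemma exists_bound_on_ball_of_forall_mul_schwartz
    (h : ∀ g : 𝓢(F, ℂ), ∃ w : 𝓢(E × F, ℂ), ∀ x y, w (x, y) = f (x, y) * g y)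
    (k l : ℕ) (R : ℝ) :
    ∃ C : ℝ, ∀ (p : E × F) (i : ℕ), i ≤ k → ‖p.2‖ ≤ R →
      (1 + ‖p.1‖) ^ l * ‖iteratedFDeriv ℝ i f p‖ ≤ C := by
  have hf := contDiff_of_forall_mul_schwartz h
  obtain ⟨φ, hφ, -⟩ := SchwartzMap.exists_bump (F := F) (R := |R| + 1) (by positivity)
  obtain ⟨w, hw⟩ := h φ
  obtain ⟨C, hC⟩ := w.exists_one_add_pow_mul_le k l
  refine ⟨C, fun p i hi hp => ?_⟩
  have hev : ∀ᶠ y in 𝓝 p.2, φ y = 1 := by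
    have : ∀ᶠ y in 𝓝 p.2, ‖y‖ < |R| + 1 :=
      continuous_norm.continuousAt.eventually
        (gt_mem_nhds (by linarith [le_abs_self R]))
    filter_upwards [this] with y hy using hφ y hy.le
  have hn := norm_iteratedFDeriv_of_eventuallyEq_const hf.contDiffAt (fun q => hw q.1 q.2) hev i
  rw [norm_one, one_mul] at hn
  rw [← hn]
  refine le_trans ?_ (hC p i hi)
  gcongr
  exact norm_fst_le p

/-- If all products `f * g` with `g` Schwartz are Schwartz, then `f` satisfies the estimates of the
mixed Schwartz–multiplier space. The proof is a gliding hump argument. -/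
lemma exists_bound_of_forall_mul_schwartz
    (h : ∀ g : 𝓢(F, ℂ), ∃ w : 𝓢(E × F, ℂ), ∀ x y, w (x, y) = f (x, y) * g y) (k l : ℕ) :
    ∃ r : ℕ, ∃ C : ℝ, ∀ (p : E × F) (i : ℕ), i ≤ k →
      (1 + ‖p.1‖) ^ l * (1 + ‖p.2‖) ^ (-(r : ℤ)) * ‖iteratedFDeriv ℝ i f p‖ ≤ C := by
  by_contra! hcon
  have hf := contDiff_of_forall_mul_schwartz h
  have key : ∀ (j : ℕ) (R : ℝ), ∃ q : E × F, R < ‖q.2‖ ∧ ∃ i ≤ k,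
      (j : ℝ) < (1 + ‖q.1‖) ^ l * (1 + ‖q.2‖) ^ (-(j : ℤ)) * ‖iteratedFDeriv ℝ i f q‖ := by
    intro j R
    obtain ⟨C, hC⟩ := exists_bound_on_ball_of_forall_mul_schwartz h k l R
    obtain ⟨q, i, hi, hq⟩ := hcon j (max C j)
    refine ⟨q, ?_, i, hi, (le_max_right _ _).trans_lt hq⟩
    by_contra! hR
    have h1 : (1 + ‖q.2‖) ^ (-(j : ℤ)) ≤ 1 := by
      rw [zpow_neg, zpow_natCast]
      exact inv_le_one_of_one_le₀ (one_le_pow₀ (by linarith [norm_nonneg q.2]))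
    refine absurd ((le_max_left C _).trans_lt hq) (not_lt.2 ?_)
    refine le_trans ?_ (hC q i hi hR)
    gcongr
    exact mul_le_of_le_one_right (by positivity) h1
  choose P hPR I hI hP using key
  let a : ℕ → E × F := fun j => Nat.rec (P 0 0) (fun j q => P (j + 1) (‖q.2‖ + 4)) j
  have ha_eq : ∀ j, ∃ R, a j = P j R := fun j => by
    cases j with
    | zero => exact ⟨_, rfl⟩
    | succ j => exact ⟨_, rfl⟩
  have ha_succ : ∀ j, ‖(a j).2‖ + 4 < ‖(a (j + 1)).2‖ := fun j => hPR (j + 1) _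
  have ha_lt : ∀ i j, i < j → ‖(a i).2‖ + 4 ≤ ‖(a j).2‖ := fun i j hij => by
    induction j, hij using Nat.le_induction with
    | base => exact (ha_succ i).le
    | succ j _ ih => linarith [ha_succ j]
  have ha_one : ∀ j, 1 ≤ j → 1 ≤ ‖(a j).2‖ := fun j hj => by
    linarith [ha_lt 0 j hj, norm_nonneg (a 0).2]
  have ha_sep : ∀ i j, i ≠ j → 4 ≤ ‖(a i).2 - (a j).2‖ := fun i j hij => by
    rcases lt_or_gt_of_ne hij with hlt | hlt
    · rw [norm_sub_rev]
      linarith [ha_lt i j hlt, norm_sub_norm_le (a j).2 (a i).2]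
    · linarith [ha_lt j i hlt, norm_sub_norm_le (a i).2 (a j).2]
  obtain ⟨φ, hφ1, hφ0⟩ := SchwartzMap.exists_bump (F := F) (R := 1) one_pos
  let c : ℕ → ℝ := fun j => (1 + ‖(a j).2‖) ^ (-(j : ℤ))
  have hc : ∀ j, 0 < c j := fun j => by positivity
  have hsum : ∀ b : ℕ, Summable fun j => c j * (1 + ‖(a j).2‖) ^ b := fun b => by
    refine Summable.of_norm_bounded_eventually_nat
      (g := fun j => 2 ^ b * (1 / 2 : ℝ) ^ j) (summable_geometric_two.mul_left _) ?_
    filter_upwards [eventually_ge_atTop (b + 1)] with j hj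
    obtain ⟨d, rfl⟩ := Nat.exists_eq_add_of_le (show b ≤ j by omega)
    have h2 : (2 : ℝ) ≤ 1 + ‖(a (b + d)).2‖ := by linarith [ha_one (b + d) (by omega)]
    have h0 : (0 : ℝ) < 1 + ‖(a (b + d)).2‖ := by linarith
    have e1 : c (b + d) * (1 + ‖(a (b + d)).2‖) ^ b = ((1 + ‖(a (b + d)).2‖) ^ d)⁻¹ := by
      simp only [c]
      rw [zpow_neg, zpow_natCast, pow_add]
      field_simp
    have e2 : (2 : ℝ) ^ b * (1 / 2 : ℝ) ^ (b + d) = (2 ^ d)⁻¹ := by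
      rw [one_div, inv_pow, pow_add]
      field_simp
    rw [e1, e2, Real.norm_of_nonneg (by positivity)]
    gcongr
  obtain ⟨g, hg⟩ := φ.exists_eq_tsum_translates c (fun j => (a j).2) (fun j => (hc j).le) hsum
  obtain ⟨w, hw⟩ := h g
  obtain ⟨B, hB⟩ := w.exists_one_add_pow_mul_le k l
  have hgj : ∀ j, ∀ᶠ y in 𝓝 (a j).2, g y = (c j : ℂ) := fun j => by
    filter_upwards [Metric.ball_mem_nhds (a j).2 one_pos] with y hy
    rw [mem_ball_iff_norm] at hy
    rw [hg, tsum_eq_single j, hφ1 _ hy.le]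
    · simp
    · intro i hij
      have h4 := ha_sep i j hij
      have h5 := norm_sub_le_norm_sub_add_norm_sub (a i).2 y (a j).2
      rw [norm_sub_rev (a i).2 y] at h5
      rw [hφ0 _ (by linarith), smul_zero]
  obtain ⟨j, hj⟩ := exists_nat_gt B
  obtain ⟨R, hR⟩ := ha_eq j
  have hlow := hP j R
  rw [← hR] at hlow
  have hn := norm_iteratedFDeriv_of_eventuallyEq_const hf.contDiffAt (fun q => hw q.1 q.2)
    (hgj j) (I j R)
  rw [Complex.norm_real, Real.norm_of_nonneg (hc j).le] at hn
  have hup := hB (a j) (I j R) (hI j R)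
  rw [hn] at hup
  have hle : (1 + ‖(a j).1‖) ^ l * (c j * ‖iteratedFDeriv ℝ (I j R) f (a j)‖) ≤ B := by
    refine le_trans ?_ hup
    have := (hc j).le
    gcongr
    exact norm_fst_le _
  rw [← mul_assoc] at hle
  linarith

end Necessity

/-- **Statement 7.** For a function `f : ℝⁿ × ℝᵐ → ℂ` the following are equivalent:
(a) for every `g ∈ 𝓢(ℝᵐ)` the function `(x, y) ↦ f (x, y) * g y` is in `𝓢(ℝ^{n+m})`;
(b) `f` is smooth and for all `k, l` there is `r` such that
`sup_{(x,y), |a| ≤ k} (1+‖x‖)^l (1+‖y‖)^{-r} ‖∂^a f (x,y)‖` is finite.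
Moreover, in that case the multiplication map `M_f : 𝓢(ℝᵐ) → 𝓢(ℝ^{n+m})`,
`M_f g (x, y) = f (x, y) * g y`, is a continuous linear map. -/
theorem statement7 (n m : ℕ) (f : Euc n × Euc m → ℂ) :
    ((∀ g : SchwartzMap (Euc m) ℂ, ∃ w : SchwartzMap (Euc n × Euc m) ℂ,
        ∀ (x : Euc n) (y : Euc m), w (x, y) = f (x, y) * g y) ↔
      (ContDiff ℝ (⊤ : ℕ∞) f ∧ ∀ k l : ℕ, ∃ r : ℕ, ∃ C : ℝ,
        ∀ (p : Euc n × Euc m) (i : ℕ), i ≤ k →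
          (1 + ‖p.1‖) ^ l * (1 + ‖p.2‖) ^ (-(r : ℤ)) * ‖iteratedFDeriv ℝ i f p‖ ≤ C)) ∧
    ((∀ g : SchwartzMap (Euc m) ℂ, ∃ w : SchwartzMap (Euc n × Euc m) ℂ,
        ∀ (x : Euc n) (y : Euc m), w (x, y) = f (x, y) * g y) →
      ∃ M : SchwartzMap (Euc m) ℂ →L[ℂ] SchwartzMap (Euc n × Euc m) ℂ,
        ∀ (g : SchwartzMap (Euc m) ℂ) (x : Euc n) (y : Euc m),
          M g (x, y) = f (x, y) * g y) := by
  have hab : (∀ g : SchwartzMap (Euc m) ℂ, ∃ w : SchwartzMap (Euc n × Euc m) ℂ,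
        ∀ (x : Euc n) (y : Euc m), w (x, y) = f (x, y) * g y) →
      (ContDiff ℝ (⊤ : ℕ∞) f ∧ ∀ k l : ℕ, ∃ r : ℕ, ∃ C : ℝ,
        ∀ (p : Euc n × Euc m) (i : ℕ), i ≤ k →
          (1 + ‖p.1‖) ^ l * (1 + ‖p.2‖) ^ (-(r : ℤ)) * ‖iteratedFDeriv ℝ i f p‖ ≤ C) := fun h =>
    ⟨contDiff_of_forall_mul_schwartz h, exists_bound_of_forall_mul_schwartz h⟩
  refine ⟨⟨hab, fun h g => ?_⟩, fun h => exists_schwartz_mulCLM (hab h).1 (hab h).2⟩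
  obtain ⟨M, hM⟩ := exists_schwartz_mulCLM h.1 h.2
  exact ⟨M g, hM g⟩
end
end

section
/- (Wick theorem for second-quantized operators.) Let l_A, l'_A, l_B, l'_B ∈ ℕ and let A : 𝓢(ℝ^{3l_A}) → 𝓢(ℝ^{3l'_A}) and B : 𝓢(ℝ^{3l_B}) → 𝓢(ℝ^{3l'_B}) be continuous linear operators satisfying Sym_{l'_A} ∘ A ∘ Sym_{l_A} = A and Sym_{l'_B} ∘ B ∘ Sym_{l_B} = B. Then for every L ∈ ℕ and every Ψ ∈ D_S^L one has Â(B̂ Ψ) = Σ_{r=0}^{min(l_A, l'_B)} r! · binom(l_A, r) · binom(l'_B, r) · ((A ⊗_r B)^∧)(Ψ), where (A ⊗_r B)^∧ denotes the second quantization of the tensor product with r contractions A ⊗_r B. -/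
noncomputable section

open SchwartzMap

/-- `ℝ³`. -/
abbrev Euc3 : Type := EuclideanSpace ℝ (Fin 3)

/-- `𝓢(ℝ^{3l})`, with the variables grouped into `l` blocks of `3`. -/
abbrev Sch (l : ℕ) : Type := SchwartzMap (Fin l → Euc3) ℂ

/-- Reindexing the blocks of variables along an equivalence of index sets, as a continuous
linear equivalence of the underlying spaces. -/
def reindexCLE {a b : ℕ} (e : Fin a ≃ Fin b) : (Fin a → Euc3) ≃L[ℝ] (Fin b → Euc3) :=
  (LinearEquiv.piCongrLeft ℝ (fun _ : Fin b => Euc3) e).toContinuousLinearEquiv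

/-- The operator on Schwartz space given by composing with a reindexing of the block
variables; for a permutation `σ` this is the block-permutation operator `P_σ`. -/
def reindexCLM {a b : ℕ} (e : Fin a ≃ Fin b) : Sch b →L[ℂ] Sch a :=
  SchwartzMap.compCLMOfContinuousLinearEquiv ℂ (reindexCLE e)

set_option synthInstance.maxHeartbeats 1000000 in
/-- The symmetrization operator `Sym_l = (1/l!) ∑_{σ ∈ S_l} P_σ`. -/
def SymCLM (l : ℕ) : Sch l →L[ℂ] Sch l :=
  ((l.factorial : ℂ))⁻¹ • ∑ σ : Equiv.Perm (Fin l), reindexCLM σ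

/-- The canonical identification `𝓢(ℝ^{3a}) → 𝓢(ℝ^{3b})` for `a = b`. -/
def castCLM {a b : ℕ} (h : a = b) : Sch a →L[ℂ] Sch b :=
  reindexCLM (finCongr h.symm)

/-- The space `D_S^l` of Schwartz functions symmetric under the block permutations. -/
def DS (l : ℕ) : Submodule ℂ (Sch l) where
  carrier := {f | ∀ (σ : Equiv.Perm (Fin l)) (p : Fin l → Euc3), f (p ∘ σ) = f p}
  add_mem' := by
    intro f g hf hg σ p
    simp [hf σ p, hg σ p]
  zero_mem' := by intro σ p; simp
  smul_mem' := by
    intro c f hf σ p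
    simp [hf σ p]

/-- `ext a k b F` is the augmentation `F ⊗ id_{3k} : 𝓢(ℝ^{3(a+k)}) → 𝓢(ℝ^{3(b+k)})`:
it is the unique continuous linear operator with `(F ⊗ id)(f ⊠ g) = F f ⊠ g` on tensor
products. -/
def ExtRSpec
    (ext : ∀ a k b : ℕ, (Sch a →L[ℂ] Sch b) → (Sch (a + k) →L[ℂ] Sch (b + k))) : Prop :=
  ∀ (a k b : ℕ) (F : Sch a →L[ℂ] Sch b) (f : Sch a) (g : Sch k) (w : Sch (a + k)),
    (∀ p : Fin (a + k) → Euc3,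
        w p = f (fun i : Fin a => p (Fin.castAdd k i)) *
          g (fun j : Fin k => p (Fin.natAdd a j))) →
    ∀ q : Fin (b + k) → Euc3,
      ext a k b F w q = F f (fun i : Fin b => q (Fin.castAdd k i)) *
        g (fun j : Fin k => q (Fin.natAdd b j))

/-- `extL k a b F` is the augmentation `id_{3k} ⊗ F : 𝓢(ℝ^{3(k+a)}) → 𝓢(ℝ^{3(k+b)})`:
it is the unique continuous linear operator with `(id ⊗ F)(g ⊠ f) = g ⊠ F f` on tensor
products. -/
def ExtLSpec
    (extL : ∀ k a b : ℕ, (Sch a →L[ℂ] Sch b) → (Sch (k + a) →L[ℂ] Sch (k + b))) : Prop :=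
  ∀ (k a b : ℕ) (F : Sch a →L[ℂ] Sch b) (g : Sch k) (f : Sch a) (w : Sch (k + a)),
    (∀ p : Fin (k + a) → Euc3,
        w p = g (fun i : Fin k => p (Fin.castAdd a i)) *
          f (fun j : Fin a => p (Fin.natAdd k j))) →
    ∀ q : Fin (k + b) → Euc3,
      extL k a b F w q = g (fun i : Fin k => q (Fin.castAdd b i)) *
        F f (fun j : Fin b => q (Fin.natAdd k j))

set_option synthInstance.maxHeartbeats 1000000 in
/-- The second quantization `Â` of `A : 𝓢(ℝ^{3l}) → 𝓢(ℝ^{3l'})` at particle number `L`: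
`Â Ψ = (√(L! (L-l+l')!) / (L-l)!) ⬝ Sym_{L-l+l'} ((A ⊗ id_{3(L-l)}) Ψ)` for `L ≥ l`, and
`Â Ψ = 0` for `L < l`. -/
def secondQ (ext : ∀ a k b : ℕ, (Sch a →L[ℂ] Sch b) → (Sch (a + k) →L[ℂ] Sch (b + k)))
    {l l' : ℕ} (A : Sch l →L[ℂ] Sch l') (L : ℕ) : Sch L →L[ℂ] Sch (L - l + l') :=
  if h : l ≤ L then
    (((Real.sqrt ((L.factorial : ℝ) * ((L - l + l').factorial : ℝ)) /
        ((L - l).factorial : ℝ)) : ℝ) : ℂ) •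
      ((SymCLM (L - l + l')).comp
        ((castCLM (show l' + (L - l) = L - l + l' by omega)).comp
          ((ext l (L - l) l' A).comp
            (castCLM (show L = l + (L - l) by omega)))))
  else 0

/-- The tensor product with `r` contractions,
`A ⊗_r B = Sym_{l'_A+l'_B-r} ∘ (A ⊗ id_{3(l'_B-r)}) ∘ (id_{3(l_A-r)} ⊗ B) ∘ Sym_{l_A+l_B-r}`
(defined to be `0` for `r` out of range). -/
def contr (ext : ∀ a k b : ℕ, (Sch a →L[ℂ] Sch b) → (Sch (a + k) →L[ℂ] Sch (b + k)))
    (extL : ∀ k a b : ℕ, (Sch a →L[ℂ] Sch b) → (Sch (k + a) →L[ℂ] Sch (k + b)))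
    {lA l'A lB l'B : ℕ} (A : Sch lA →L[ℂ] Sch l'A) (B : Sch lB →L[ℂ] Sch l'B)
    (r : ℕ) : Sch (lA + lB - r) →L[ℂ] Sch (l'A + l'B - r) :=
  if h : r ≤ lA ∧ r ≤ l'B then
    (SymCLM (l'A + l'B - r)).comp <|
      (castCLM (show l'A + (l'B - r) = l'A + l'B - r by omega)).comp <|
        (ext lA (l'B - r) l'A A).comp <|
          (castCLM (show lA - r + l'B = lA + (l'B - r) by omega)).comp <|
            (extL (lA - r) lB l'B B).comp <|
              (castCLM (show lA + lB - r = lA - r + lB by omega)).comp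
                (SymCLM (lA + lB - r))
  else 0

section Density
open Filter Topology

variable {V : Type*} [NormedAddCommGroup V] [NormedSpace ℝ V]

theorem SchwartzMap.seminorm_le_tsum {κ : Type*} (u : κ → 𝓢(V, ℂ)) (f : 𝓢(V, ℂ))
    (hs : ∀ m n : ℕ, Summable fun k => SchwartzMap.seminorm ℝ m n (u k))
    (hf : ∀ x, HasSum (fun k => u k x) (f x)) (m n : ℕ) :
    SchwartzMap.seminorm ℝ m n f ≤ ∑' k, SchwartzMap.seminorm ℝ m n (u k) := by
  have hfun : (f : V → ℂ) = fun x => ∑' k, u k x := funext fun x => (hf x).tsum_eq.symm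
  have hder : ∀ x, iteratedFDeriv ℝ n f x = ∑' k, iteratedFDeriv ℝ n (u k) x := by
    intro x
    rw [hfun]
    exact iteratedFDeriv_tsum_apply (𝕜 := ℝ) (N := ⊤) (f := fun k => (u k : V → ℂ))
      (v := fun j k => SchwartzMap.seminorm ℝ 0 j (u k))
      (fun k => (u k).smooth ⊤) (fun j _ => hs 0 j)
      (fun j k x _ => (u k).norm_iteratedFDeriv_le_seminorm ℝ j x) le_top x
  refine f.seminorm_le_bound ℝ m n (tsum_nonneg fun k => apply_nonneg _ _) fun x => ?_
  have hsum : Summable fun k => ‖iteratedFDeriv ℝ n (u k) x‖ :=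
    (hs 0 n).of_nonneg_of_le (fun _ => norm_nonneg _)
      fun k => (u k).norm_iteratedFDeriv_le_seminorm ℝ n x
  calc ‖x‖ ^ m * ‖iteratedFDeriv ℝ n f x‖
      ≤ ‖x‖ ^ m * ∑' k, ‖iteratedFDeriv ℝ n (u k) x‖ := by
        rw [hder x]
        gcongr
        exact norm_tsum_le_tsum_norm hsum
    _ = ∑' k, ‖x‖ ^ m * ‖iteratedFDeriv ℝ n (u k) x‖ := tsum_mul_left.symm
    _ ≤ _ := (hsum.mul_left _).tsum_le_tsum (fun k => (u k).le_seminorm ℝ m n x) (hs m n)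

theorem SchwartzMap.hasSum_of_hasSum_apply {κ : Type*} (u : κ → 𝓢(V, ℂ)) (f : 𝓢(V, ℂ))
    (hs : ∀ m n : ℕ, Summable fun k => SchwartzMap.seminorm ℝ m n (u k))
    (hf : ∀ x, HasSum (fun k => u k x) (f x)) : HasSum u f := by
  classical
  refine ((schwartz_withSeminorms ℝ V ℂ).tendsto_nhds _ _).2 ?_
  rintro ⟨m, n⟩ ε hε
  filter_upwards [(tendsto_tsum_compl_atTop_zero
    fun k => SchwartzMap.seminorm ℝ m n (u k)).eventually (gt_mem_nhds hε)] with F hF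
  have key := SchwartzMap.seminorm_le_tsum (fun k : {k // k ∉ F} => u k) (f - ∑ k ∈ F, u k)
    (fun m n => (hs m n).subtype _)
    (fun x => by
      have h := (Finset.hasSum_compl_iff (f := fun k => u k x) F (a := f x - ∑ k ∈ F, u k x)).2
        (by simpa using hf x)
      simpa [sum_apply] using h) m n
  rw [← map_neg_eq_map, neg_sub]
  exact key.trans_lt hF

theorem SchwartzMap.tendsto_smulLeftCLM_scaled (χ : V → ℂ) (hχ : ContDiff ℝ (⊤ : ℕ∞) χ)
    (hc : HasCompactSupport χ) (h1 : χ =ᶠ[𝓝 0] 1) (f : 𝓢(V, ℂ)) (g : ℕ → 𝓢(V, ℂ))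
    (hg : ∀ R x, g R x = χ ((R + 1 : ℝ)⁻¹ • x) * f x) :
    Tendsto g atTop (𝓝 f) := by
  have hbound : ∀ i, ∃ C, 0 ≤ C ∧ ∀ (r : ℝ) (x : V), 0 ≤ r → r ≤ 1 →
      ‖iteratedFDeriv ℝ i (fun x => χ (r • x) - 1) x‖ ≤ r * (C * (1 + ‖x‖)) := by
    intro i
    set S := hc.toSchwartzMap hχ with hS
    have hSχ : (S : V → ℂ) = χ := rfl
    rcases Nat.eq_zero_or_pos i with rfl | hi
    · obtain ⟨δ, hδ, hball⟩ := Metric.eventually_nhds_iff.1 h1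
      set K := SchwartzMap.seminorm ℝ 0 0 S + 1 with hK
      have hK0 : 0 ≤ K := by positivity
      refine ⟨K / δ, by positivity, fun r x hr _ => ?_⟩
      rw [norm_iteratedFDeriv_zero]
      by_cases hx : dist (r • x) 0 < δ
      · rw [hball hx]
        simp only [Pi.one_apply, sub_self, norm_zero]
        positivity
      · rw [dist_zero_right, norm_smul, Real.norm_of_nonneg hr, not_lt] at hx
        calc ‖χ (r • x) - 1‖ ≤ ‖χ (r • x)‖ + ‖(1 : ℂ)‖ := norm_sub_le _ _
          _ ≤ K := by
            rw [hK, norm_one]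
            gcongr
            exact S.norm_le_seminorm ℝ _
          _ ≤ K * (r * ‖x‖ / δ) := le_mul_of_one_le_right hK0 ((one_le_div hδ).2 hx)
          _ = r * (K / δ * ‖x‖) := by ring
          _ ≤ _ := by
            gcongr
            linarith
    · refine ⟨SchwartzMap.seminorm ℝ 0 i S, by positivity, fun r x hr hr1 => ?_⟩
      set L : V →L[ℝ] V := r • ContinuousLinearMap.id ℝ V with hL
      have hLn : ‖L‖ ≤ r := by
        rw [hL, norm_smul, Real.norm_of_nonneg hr]
        exact mul_le_of_le_one_right hr ContinuousLinearMap.norm_id_le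
      have hcomp : (fun x => χ (r • x)) = χ ∘ L := by ext; simp [hL]
      have hχi : ContDiff ℝ i χ := hχ.of_le (by exact_mod_cast le_top)
      have hsub : iteratedFDeriv ℝ i (fun x => χ (r • x) - 1) x =
          iteratedFDeriv ℝ i (χ ∘ L) x := by
        rw [fun_iteratedFDeriv_sub_apply (by rw [hcomp]; exact (hχi.comp L.contDiff).contDiffAt)
          contDiffAt_const, iteratedFDeriv_const_of_ne hi.ne', hcomp]
        simp
      rw [hsub, L.iteratedFDeriv_comp_right hχi x le_rfl]
      calc _ ≤ ‖iteratedFDeriv ℝ i χ (L x)‖ * ∏ _j : Fin i, ‖L‖ :=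
            ContinuousMultilinearMap.norm_compContinuousLinearMap_le _ _
        _ ≤ SchwartzMap.seminorm ℝ 0 i S * r ^ i := by
            rw [Finset.prod_const, Finset.card_univ, Fintype.card_fin]
            gcongr
            exact S.norm_iteratedFDeriv_le_seminorm ℝ i _
        _ ≤ SchwartzMap.seminorm ℝ 0 i S * r := by
            gcongr
            exact pow_le_of_le_one hr hr1 hi.ne'
        _ = r * (SchwartzMap.seminorm ℝ 0 i S * 1) := by ring
        _ ≤ _ := by
            gcongr
            linarith [norm_nonneg x]
  choose C hC0 hC using hbound
  refine ((schwartz_withSeminorms ℝ V ℂ).tendsto_nhds _ _).2 ?_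
  rintro ⟨m, n⟩ ε hε
  set K := ∑ i ∈ Finset.range (n + 1), (n.choose i : ℝ) * (C i *
    (SchwartzMap.seminorm ℝ m (n - i) f + SchwartzMap.seminorm ℝ (m + 1) (n - i) f)) with hK
  have hK0 : 0 ≤ K := Finset.sum_nonneg fun i _ => by have := hC0 i; positivity
  have hle : ∀ R : ℕ, SchwartzMap.seminorm ℝ m n (g R - f) ≤ (R + 1 : ℝ)⁻¹ * K := by
    intro R
    set r : ℝ := (R + 1 : ℝ)⁻¹ with hr
    have hr0 : 0 ≤ r := by positivity
    have hr1 : r ≤ 1 := inv_le_one_of_one_le₀ (by linarith [(Nat.cast_nonneg R : (0:ℝ) ≤ R)])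
    refine SchwartzMap.seminorm_le_bound ℝ m n _ (by positivity) fun x => ?_
    have hfun : ((g R - f : 𝓢(V, ℂ)) : V → ℂ) = fun x => (χ (r • x) - 1) * f x := by
      ext y
      rw [sub_apply, hg]
      ring
    have hu : ContDiff ℝ (⊤ : ℕ∞) fun x : V => χ (r • x) - 1 :=
      (hχ.comp (contDiff_const_smul r)).sub contDiff_const
    rw [hfun]
    calc _ ≤ ‖x‖ ^ m * ∑ i ∈ Finset.range (n + 1), (n.choose i : ℝ) *
            ‖iteratedFDeriv ℝ i (fun x => χ (r • x) - 1) x‖ * ‖iteratedFDeriv ℝ (n - i) f x‖ := by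
          gcongr
          exact norm_iteratedFDeriv_mul_le hu (f.smooth ⊤) x (by exact_mod_cast le_top)
      _ ≤ ‖x‖ ^ m * ∑ i ∈ Finset.range (n + 1), (n.choose i : ℝ) *
            (r * (C i * (1 + ‖x‖))) * ‖iteratedFDeriv ℝ (n - i) f x‖ := by
          gcongr with i
          exact hC i r x hr0 hr1
      _ = r * ∑ i ∈ Finset.range (n + 1), (n.choose i : ℝ) * (C i *
            (‖x‖ ^ m * ‖iteratedFDeriv ℝ (n - i) f x‖ +
              ‖x‖ ^ (m + 1) * ‖iteratedFDeriv ℝ (n - i) f x‖)) := by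
          rw [Finset.mul_sum, Finset.mul_sum]
          refine Finset.sum_congr rfl fun i _ => ?_
          ring
      _ ≤ _ := by
          rw [hK]
          gcongr with i
          · exact hC0 i
          · exact f.le_seminorm ℝ _ _ x
          · exact f.le_seminorm ℝ _ _ x
  have hlim : Tendsto (fun R : ℕ => (R + 1 : ℝ)⁻¹ * K) atTop (𝓝 0) := by
    simpa using (tendsto_one_div_add_atTop_nhds_zero_nat (𝕜 := ℝ)).mul_const K
  filter_upwards [hlim.eventually (gt_mem_nhds hε)] with R hR
  exact (hle R).trans_lt hR

end Density

section Fourier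
open Filter Topology MeasureTheory FourierTransform

variable {ι : Type*}

/-- An integer vector as a vector of Euclidean space. -/
def intVec (k : ι → ℤ) : EuclideanSpace ℝ ι := WithLp.toLp 2 fun i => (k i : ℝ)

theorem intVec_injective : Function.Injective (intVec (ι := ι)) := by
  intro k l h
  ext i
  simpa [intVec] using congrArg (fun v : EuclideanSpace ℝ ι => v i) h

/-- Coordinatewise reduction of a vector modulo the integers. -/
def toTorus (x : ι → ℝ) : UnitAddTorus ι := fun i => (x i : UnitAddCircle)

theorem isOpenQuotientMap_toTorus : IsOpenQuotientMap (toTorus (ι := ι)) :=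
  IsOpenQuotientMap.piMap fun _ => QuotientAddGroup.isOpenQuotientMap_mk

variable [Fintype ι]

theorem SchwartzMap.summable_intVec (f : 𝓢(EuclideanSpace ℝ ι, ℂ)) (N : ℕ) :
    Summable fun k : ι → ℤ => (1 + ‖intVec k‖) ^ N * ‖f (intVec k)‖ := by
  classical
  set b := (EuclideanSpace.basisFun ι ℝ).toBasis
  set Λ : Submodule ℤ (EuclideanSpace ℝ ι) := Submodule.span ℤ (Set.range b) with hΛ
  have hmem : ∀ k : ι → ℤ, intVec k ∈ Λ := by
    intro k
    have : intVec k = ∑ i, k i • b i := by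
      ext j
      simp [intVec, b, Pi.single_apply]
    rw [this]
    exact Submodule.sum_mem _ fun i _ => Λ.smul_mem _ (Submodule.subset_span ⟨i, rfl⟩)
  set n := Module.finrank ℤ Λ + 1 with hn
  have hsum : Summable fun k : ι → ℤ => (‖intVec k‖ ^ n)⁻¹ := by
    simp_rw [← inv_pow]
    exact (ZLattice.summable_norm_pow_inv Λ n (Nat.lt_succ_self _)).comp_injective
      (i := fun k : ι → ℤ => (⟨intVec k, hmem k⟩ : Λ))
      fun k l h => intVec_injective (congrArg Subtype.val h)
  set C := 2 ^ (N + n) * ((Finset.Iic (N + n, 0)).sup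
    fun m => SchwartzMap.seminorm ℝ m.1 m.2) f with hC
  refine Summable.of_norm_bounded_eventually (hsum.mul_left C) ?_
  filter_upwards [(Set.finite_singleton (0 : ι → ℤ)).compl_mem_cofinite] with k hk
  have hpos : 0 < ‖intVec k‖ := by
    rw [norm_pos_iff]
    intro h0
    exact hk (intVec_injective (h0.trans (by ext; simp [intVec])))
  have h1 := SchwartzMap.one_add_le_sup_seminorm_apply (𝕜 := ℝ) (m := (N + n, 0)) (k := N + n)
    (n := 0) le_rfl le_rfl f (intVec k)
  rw [norm_iteratedFDeriv_zero] at h1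
  rw [Real.norm_of_nonneg (by positivity), ← div_eq_mul_inv, le_div_iff₀ (by positivity)]
  refine le_trans ?_ h1
  calc _ = (1 + ‖intVec k‖) ^ N * ‖intVec k‖ ^ n * ‖f (intVec k)‖ := by ring
    _ ≤ (1 + ‖intVec k‖) ^ N * (1 + ‖intVec k‖) ^ n * ‖f (intVec k)‖ := by
      gcongr
      linarith
    _ = _ := by rw [pow_add _ N n]

theorem exists_continuousMap_torus (h : (ι → ℝ) → ℂ) (hc : Continuous h)
    (hsupp : ∀ x, (∃ i, 1 / 4 ≤ |x i|) → h x = 0) :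
    ∃ F : C(UnitAddTorus ι, ℂ), ∀ x : ι → ℝ, F (toTorus x) = h fun i => x i - round (x i) := by
  have hcont : Continuous fun x : ι → ℝ => h fun i => x i - round (x i) := by
    rw [continuous_iff_continuousAt]
    intro x
    by_cases hx : ∀ i, |x i - round (x i)| < 1 / 2
    · have hev : (fun y : ι → ℝ => h fun i => y i - round (y i)) =ᶠ[𝓝 x]
          fun y => h fun i => y i - round (x i) := by
        have : ∀ᶠ y : ι → ℝ in 𝓝 x, ∀ i, |y i - round (x i)| < 1 / 2 := by
          rw [eventually_all]
          intro i
          have : ContinuousAt (fun y : ι → ℝ => |y i - round (x i)|) x :=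
            ((continuous_apply i).sub continuous_const).abs.continuousAt
          exact this.eventually_lt continuousAt_const (hx i)
        filter_upwards [this] with y hy
        congr 1
        ext i
        have hi := abs_lt.1 (hy i)
        rw [round_eq_iff.2 (show y i ∈ Set.Ico
          (((round (x i) : ℤ) : ℝ) - 1 / 2) (round (x i) + 1 / 2)
          from ⟨by linarith, by linarith⟩)]
      refine ContinuousAt.congr ?_ hev.symm
      exact (hc.comp (by fun_prop)).continuousAt
    · push Not at hx
      obtain ⟨i, hi⟩ := hx
      have hev : (fun y : ι → ℝ => h fun i => y i - round (y i)) =ᶠ[𝓝 x] fun _ => 0 := by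
        have hci : ContinuousAt (fun y : ι → ℝ => |y i - x i|) x :=
          ((continuous_apply i).sub continuous_const).abs.continuousAt
        filter_upwards [hci.eventually_lt (g := fun _ => (1 / 4 : ℝ)) continuousAt_const (by simp)]
          with y hy
        refine hsupp _ ⟨i, ?_⟩
        have h1 := hi.trans (round_le (x i) (round (y i)))
        have h2 := abs_sub_abs_le_abs_sub (x i - round (y i)) (y i - round (y i))
        rw [sub_sub_sub_cancel_right, abs_sub_comm (x i) (y i)] at h2
        change |y i - x i| < 1 / 4 at hy
        linarith
      exact ContinuousAt.congr continuousAt_const hev.symm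
  have hfac : ∀ x y : ι → ℝ, toTorus x = toTorus y →
      (h fun i => x i - round (x i)) = h fun i => y i - round (y i) := by
    intro x y hxy
    congr 1
    ext i
    have hi : (x i : UnitAddCircle) = y i := congrFun hxy i
    rw [← sub_eq_zero, ← AddCircle.coe_sub, AddCircle.coe_eq_zero_iff] at hi
    obtain ⟨n, hn⟩ := hi
    have hxn : x i = y i + n := by
      rw [zsmul_eq_mul, mul_one] at hn
      linarith
    rw [hxn, round_add_intCast]
    push_cast
    ring
  refine ⟨⟨Function.extend toTorus (fun x => h fun i => x i - round (x i)) 0, ?_⟩, fun x => ?_⟩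
  · rw [isOpenQuotientMap_toTorus.isQuotientMap.continuous_iff]
    convert hcont using 1
    ext x
    exact Function.FactorsThrough.extend_apply (fun a b => hfac a b) _ x
  · exact Function.FactorsThrough.extend_apply (fun a b => hfac a b) _ x

theorem hasSum_fourier_of_support (h : 𝓢(EuclideanSpace ℝ ι, ℂ))
    (hsupp : ∀ x : EuclideanSpace ℝ ι, (∃ i, 1 / 4 ≤ |x i|) → h x = 0)
    (x : EuclideanSpace ℝ ι) (hx : ∀ i, |x i| < 1 / 2) :
    HasSum (fun k : ι → ℤ => (𝓕 h : 𝓢(EuclideanSpace ℝ ι, ℂ)) (intVec k) *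
      ∏ i, fourier (k i) (x i : UnitAddCircle)) (h x) := by
  obtain ⟨F, hF⟩ := exists_continuousMap_torus (fun y => h (WithLp.toLp 2 y))
    (h.continuous.comp (PiLp.continuous_toLp 2 _)) fun y hy => hsupp _ hy
  have hFh : ∀ y : ι → ℝ, (∀ i, y i ∈ Set.Ioc (-1 / 2 : ℝ) (-1 / 2 + 1)) →
      F (toTorus y) = h (WithLp.toLp 2 y) := by
    intro y hy
    rw [hF]
    by_cases hlt : ∀ i, y i < 1 / 2
    · congr 2
      ext i
      rw [round_eq_zero_iff.2 ⟨by linarith [(hy i).1], hlt i⟩, Int.cast_zero, sub_zero]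
    · push Not at hlt
      obtain ⟨i, hi⟩ := hlt
      have hyi : y i = 2⁻¹ := by linarith [(hy i).2]
      rw [hsupp _ ⟨i, ?_⟩, hsupp _ ⟨i, ?_⟩]
      · simp [hyi, abs_of_pos]
        norm_num
      · simp only [hyi, round_two_inv]
        norm_num [abs_of_neg]
  have hcoeff : ∀ k, UnitAddTorus.mFourierCoeff F k =
      (𝓕 h : 𝓢(EuclideanSpace ℝ ι, ℂ)) (intVec k) := by
    intro k
    rw [UnitAddTorus.mFourierCoeff_eq_integral F k (fun _ => -1 / 2), SchwartzMap.fourier_coe,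
      Real.fourier_eq', ← (PiLp.volume_preserving_toLp ι).integral_comp
        (MeasurableEquiv.toLp 2 (ι → ℝ)).measurableEmbedding]
    rw [← integral_indicator (by measurability)]
    congr 1
    ext y
    by_cases hy : y ∈ {x : ι → ℝ | ∀ i, x i ∈ Set.Ioc (-1 / 2 : ℝ) (-1 / 2 + 1)}
    · rw [Set.indicator_of_mem hy]
      change _ • F (toTorus y) = _
      rw [hFh y hy]
      congr 1
      change ∏ i, fourier ((-k) i) (y i : UnitAddCircle) = _
      simp_rw [fourier_coe_apply, ← Complex.exp_sum]
      congr 1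
      simp only [intVec, PiLp.inner_apply]
      push_cast
      rw [Finset.mul_sum, Finset.sum_mul]
      refine Finset.sum_congr rfl fun i _ => ?_
      simp
      ring
    · rw [Set.indicator_of_notMem hy, hsupp, smul_zero]
      simp only [Set.mem_ofPred_eq, not_forall] at hy
      obtain ⟨i, hi⟩ := hy
      refine ⟨i, ?_⟩
      by_contra hlt
      rw [not_le, abs_lt] at hlt
      change -(1 / 4) < y i ∧ y i < 1 / 4 at hlt
      exact hi ⟨by linarith, by linarith⟩
  have hsummable : Summable (UnitAddTorus.mFourierCoeff F) := by
    refine Summable.of_norm ?_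
    simp_rw [hcoeff]
    simpa only [pow_zero, one_mul] using (𝓕 h : 𝓢(EuclideanSpace ℝ ι, ℂ)).summable_intVec 0
  have hsum := UnitAddTorus.hasSum_mFourier_series_apply_of_summable hsummable (toTorus x)
  rw [hFh x fun i => ⟨by linarith [(abs_lt.1 (hx i)).1], by linarith [(abs_lt.1 (hx i)).2]⟩] at hsum
  simp_rw [hcoeff] at hsum
  exact hsum

end Fourier

section EuclideanDensity
open Filter Topology MeasureTheory FourierTransform

theorem iteratedDeriv_cexp_mul_ofReal (c : ℂ) (n : ℕ) :
    iteratedDeriv n (fun t : ℝ => Complex.exp (c * t)) =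
      fun t : ℝ => c ^ n * Complex.exp (c * t) := by
  induction n with
  | zero => simp
  | succ n ih =>
    rw [iteratedDeriv_succ, ih]
    ext t
    have h : HasDerivAt (fun t : ℝ => Complex.exp (c * t)) (Complex.exp (c * t) * (c * 1)) t :=
      ((Complex.ofRealCLM.hasDerivAt (x := t)).const_mul c).cexp
    rw [(h.const_mul (c ^ n)).deriv]
    ring

theorem SchwartzMap.exists_seminorm_character_mul_le {E : Type*} [NormedAddCommGroup E]
    [NormedSpace ℝ E] (Θ : 𝓢(E, ℂ)) (m n : ℕ) :
    ∃ C, 0 ≤ C ∧ ∀ (ℓ : E →L[ℝ] ℝ) (w : 𝓢(E, ℂ)),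
      (∀ x, w x = Complex.exp (2 * Real.pi * Complex.I * ℓ x) * Θ x) →
      SchwartzMap.seminorm ℝ m n w ≤ C * (1 + ‖ℓ‖) ^ n := by
  refine ⟨∑ i ∈ Finset.range (n + 1), (n.choose i : ℝ) * (2 * Real.pi) ^ i *
    SchwartzMap.seminorm ℝ m (n - i) Θ, Finset.sum_nonneg fun i _ => by positivity, ?_⟩
  intro ℓ w hw
  set e : ℝ → ℂ := fun t => Complex.exp (2 * Real.pi * Complex.I * t) with he
  have hes : ContDiff ℝ (⊤ : ℕ∞) e := by
    have : ContDiff ℝ (⊤ : ℕ∞) fun t : ℝ => (t : ℂ) := Complex.ofRealCLM.contDiff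
    exact (contDiff_const.mul this).cexp
  have hed : ∀ i t, ‖iteratedFDeriv ℝ i e t‖ ≤ (2 * Real.pi) ^ i := by
    intro i t
    rw [norm_iteratedFDeriv_eq_norm_iteratedDeriv, iteratedDeriv_cexp_mul_ofReal, norm_mul,
      Complex.norm_exp]
    simp [abs_of_pos Real.pi_pos]
  have hcomp : ∀ i x, ‖iteratedFDeriv ℝ i (e ∘ ℓ) x‖ ≤
      (2 * Real.pi) ^ i * (1 + ‖ℓ‖) ^ n ∨ n < i := by
    intro i x
    rcases lt_or_ge n i with h | h
    · exact Or.inr h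
    left
    rw [ℓ.iteratedFDeriv_comp_right (hes.of_le (by exact_mod_cast le_top) : ContDiff ℝ i e)
      x le_rfl]
    calc _ ≤ ‖iteratedFDeriv ℝ i e (ℓ x)‖ * ∏ _j : Fin i, ‖ℓ‖ :=
            ContinuousMultilinearMap.norm_compContinuousLinearMap_le _ _
      _ ≤ (2 * Real.pi) ^ i * (1 + ‖ℓ‖) ^ n := by
        rw [Finset.prod_const, Finset.card_univ, Fintype.card_fin]
        gcongr
        · exact hed i _
        · calc ‖ℓ‖ ^ i ≤ (1 + ‖ℓ‖) ^ i := by gcongr; linarith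
            _ ≤ _ := pow_le_pow_right₀ (by linarith [norm_nonneg ℓ]) h
  refine SchwartzMap.seminorm_le_bound ℝ m n _
    (mul_nonneg (Finset.sum_nonneg fun i _ => by positivity) (by positivity)) fun x => ?_
  have hfun : (w : E → ℂ) = fun x => (e ∘ ℓ) x * Θ x := funext hw
  rw [hfun]
  calc _ ≤ ‖x‖ ^ m * ∑ i ∈ Finset.range (n + 1), (n.choose i : ℝ) *
            ‖iteratedFDeriv ℝ i (e ∘ ℓ) x‖ * ‖iteratedFDeriv ℝ (n - i) Θ x‖ := by
        gcongr
        exact norm_iteratedFDeriv_mul_le (hes.comp ℓ.contDiff) (Θ.smooth ⊤) x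
          (by exact_mod_cast le_top)
    _ ≤ ‖x‖ ^ m * ∑ i ∈ Finset.range (n + 1), (n.choose i : ℝ) *
            ((2 * Real.pi) ^ i * (1 + ‖ℓ‖) ^ n) * ‖iteratedFDeriv ℝ (n - i) Θ x‖ := by
        gcongr with i hi
        exact (hcomp i x).resolve_right (by have := Finset.mem_range.1 hi; omega)
    _ = (∑ i ∈ Finset.range (n + 1), (n.choose i : ℝ) * (2 * Real.pi) ^ i *
          (‖x‖ ^ m * ‖iteratedFDeriv ℝ (n - i) Θ x‖)) * (1 + ‖ℓ‖) ^ n := by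
        rw [Finset.mul_sum, Finset.sum_mul]
        refine Finset.sum_congr rfl fun i _ => ?_
        ring
    _ ≤ _ := by
        gcongr with i
        exact Θ.le_seminorm ℝ _ _ x

/-- Smooth compactly supported functions. -/
def IsTest {E : Type*} [NormedAddCommGroup E] [NormedSpace ℝ E] (g : E → ℂ) : Prop :=
  ContDiff ℝ (⊤ : ℕ∞) g ∧ HasCompactSupport g

variable {ι : Type*} [Fintype ι]

theorem exists_isTest_eq_one {a b : ℝ} (ha : 0 < a) (hab : a < b) :
    ∃ θ : ℝ → ℂ, IsTest θ ∧ (∀ t, |t| ≤ a → θ t = 1) ∧ ∀ t, b ≤ |t| → θ t = 0 := by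
  let f : ContDiffBump (0 : ℝ) := ⟨a, b, ha, hab⟩
  refine ⟨fun t => (f t : ℂ), ⟨Complex.ofRealCLM.contDiff.comp f.contDiff,
    f.hasCompactSupport.comp_left Complex.ofReal_zero⟩, fun t ht => ?_, fun t ht => ?_⟩
  · change ((f t : ℝ) : ℂ) = 1
    rw [f.one_of_mem_closedBall (by simpa using ht), Complex.ofReal_one]
  · change ((f t : ℝ) : ℂ) = 0
    rw [f.zero_of_le_dist (by simpa using ht), Complex.ofReal_zero]

theorem isTest_prod_coord {E : Type*} [NormedAddCommGroup E] [NormedSpace ℝ E]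
    {F : Type*} [NormedAddCommGroup F] [NormedSpace ℝ F] (e : E ≃L[ℝ] (ι → F))
    (g : ι → F → ℂ) (hg : ∀ i, IsTest (g i)) :
    IsTest fun x : E => ∏ i, g i (e x i) := by
  refine ⟨contDiff_prod fun i _ => (hg i).1.comp
    (((ContinuousLinearMap.proj (R := ℝ) (φ := fun _ : ι => F) i).comp
      (e : E →L[ℝ] ι → F)).contDiff), ?_⟩
  have hK : IsCompact (Set.univ.pi fun i => tsupport (g i)) := isCompact_univ_pi fun i => (hg i).2
  refine HasCompactSupport.intro (hK.image e.symm.continuous) fun x hx => ?_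
  by_contra hne
  refine hx ⟨e x, fun i _ => subset_tsupport _ fun h0 => hne
    (Finset.prod_eq_zero (Finset.mem_univ i) h0), by simp⟩

/-- `w` is a product of test functions of one variable. -/
def IsCoordProduct (w : 𝓢(EuclideanSpace ℝ ι, ℂ)) : Prop :=
  ∃ g : ι → ℝ → ℂ, (∀ i, IsTest (g i)) ∧ ∀ x, w x = ∏ i, g i (x i)

theorem mem_of_eq_mul_bump {W : Submodule ℂ 𝓢(EuclideanSpace ℝ ι, ℂ)}
    (hW : IsClosed (W : Set 𝓢(EuclideanSpace ℝ ι, ℂ))) (hprod : ∀ w, IsCoordProduct w → w ∈ W)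
    (h : 𝓢(EuclideanSpace ℝ ι, ℂ))
    (hsupp : ∀ x : EuclideanSpace ℝ ι, (∃ i, 1 / 4 ≤ |x i|) → h x = 0) : h ∈ W := by
  obtain ⟨θ, hθ, hθ1, hθ0⟩ := exists_isTest_eq_one (a := 1 / 4) (b := 1 / 2)
      (by norm_num) (by norm_num)
  set ec := EuclideanSpace.equiv ι ℝ
  have hΘt := isTest_prod_coord ec (fun _ => θ) fun _ => hθ
  set Θ : 𝓢(EuclideanSpace ℝ ι, ℂ) := hΘt.2.toSchwartzMap hΘt.1
  have hchar : ∀ n : ℤ, IsTest fun t : ℝ => fourier n (t : UnitAddCircle) * θ t := by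
    intro n
    refine ⟨ContDiff.mul ?_ hθ.1, hθ.2.mul_left⟩
    simp_rw [fourier_coe_apply]
    have : ContDiff ℝ (⊤ : ℕ∞) fun t : ℝ => (t : ℂ) := Complex.ofRealCLM.contDiff
    fun_prop
  have hwt := fun k : ι → ℤ =>
      isTest_prod_coord ec (fun i t => fourier (k i) (t : UnitAddCircle) * θ t)
    fun i => hchar (k i)
  set w : (ι → ℤ) → 𝓢(EuclideanSpace ℝ ι, ℂ) := fun k => (hwt k).2.toSchwartzMap (hwt k).1
  have hw : ∀ k x, w k x = ∏ i, (fourier (k i) (x i : UnitAddCircle) * θ (x i)) := fun _ _ => rfl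
  have hΘ : ∀ x, Θ x = ∏ i, θ (x i) := fun _ => rfl
  have hwW : ∀ k, w k ∈ W := fun k => hprod _ ⟨_, fun i => hchar (k i), hw k⟩
  have hwe : ∀ k x, w k x =
      Complex.exp (2 * Real.pi * Complex.I * (innerSL ℝ (intVec k) x : ℝ)) * Θ x := by
    intro k x
    rw [hw, Finset.prod_mul_distrib, hΘ]
    congr 1
    simp_rw [fourier_coe_apply, ← Complex.exp_sum]
    congr 1
    simp only [intVec, innerSL_apply_apply, PiLp.inner_apply]
    push_cast
    rw [Finset.mul_sum]
    refine Finset.sum_congr rfl fun i _ => ?_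
    simp
    ring
  have hsum : HasSum (fun k => (𝓕 h : 𝓢(EuclideanSpace ℝ ι, ℂ)) (intVec k) • w k) h := by
    refine SchwartzMap.hasSum_of_hasSum_apply _ _ (fun m n => ?_) fun x => ?_
    · obtain ⟨C, hC0, hC⟩ := Θ.exists_seminorm_character_mul_le m n
      refine Summable.of_nonneg_of_le (fun k => apply_nonneg _ _) (fun k => ?_)
        (((𝓕 h : 𝓢(EuclideanSpace ℝ ι, ℂ)).summable_intVec n).mul_left C)
      have h1 : SchwartzMap.seminorm ℝ m n ((𝓕 h : 𝓢(EuclideanSpace ℝ ι, ℂ)) (intVec k) • w k) =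
          ‖(𝓕 h : 𝓢(EuclideanSpace ℝ ι, ℂ)) (intVec k)‖ * SchwartzMap.seminorm ℝ m n (w k) :=
        map_smul_eq_mul (SchwartzMap.seminorm ℂ m n) _ _
      have h2 := hC _ (w k) (hwe k)
      rw [innerSL_apply_norm] at h2
      rw [h1]
      calc _ ≤ ‖(𝓕 h : 𝓢(EuclideanSpace ℝ ι, ℂ)) (intVec k)‖ * (C * (1 + ‖intVec k‖) ^ n) := by
            gcongr
        _ = _ := by ring
    · have hterm : ∀ k, ((𝓕 h : 𝓢(EuclideanSpace ℝ ι, ℂ)) (intVec k) • w k) x =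
          (𝓕 h : 𝓢(EuclideanSpace ℝ ι, ℂ)) (intVec k) *
            (∏ i, fourier (k i) (x i : UnitAddCircle)) * ∏ i, θ (x i) := by
        intro k
        rw [smul_apply, hw, Finset.prod_mul_distrib, smul_eq_mul, mul_assoc]
      simp_rw [hterm]
      by_cases hx : ∀ i, |x i| < 1 / 2
      · have := (hasSum_fourier_of_support h hsupp x hx).mul_right (∏ i, θ (x i))
        have hx' : h x * ∏ i, θ (x i) = h x := by
          by_cases hx4 : ∃ i, 1 / 4 ≤ |x i|
          · rw [hsupp x hx4, zero_mul]
          · push Not at hx4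
            rw [Finset.prod_eq_one fun i _ => hθ1 _ (hx4 i).le, mul_one]
        rwa [hx'] at this
      · push Not at hx
        obtain ⟨i, hi⟩ := hx
        rw [hsupp x ⟨i, by linarith⟩, Finset.prod_eq_zero (Finset.mem_univ i) (hθ0 _ hi)]
        simp
  exact hW.mem_of_tendsto hsum (Eventually.of_forall fun F =>
    W.sum_mem fun k _ => W.smul_mem _ (hwW k))

theorem closed_submodule_eq_top {W : Submodule ℂ 𝓢(EuclideanSpace ℝ ι, ℂ)}
    (hW : IsClosed (W : Set 𝓢(EuclideanSpace ℝ ι, ℂ))) (hprod : ∀ w, IsCoordProduct w → w ∈ W) :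
    W = ⊤ := by
  refine Submodule.eq_top_iff'.2 fun f => ?_
  obtain ⟨θ, hθ, hθ1, hθ0⟩ := exists_isTest_eq_one (a := 1 / 8) (b := 1 / 4)
      (by norm_num) (by norm_num)
  set ec := EuclideanSpace.equiv ι ℝ
  have hχ := isTest_prod_coord ec (fun _ => θ) fun _ => hθ
  set χ : EuclideanSpace ℝ ι → ℂ := fun x => ∏ i, θ (ec x i)
  have hscale : ∀ R : ℕ, ∃ u ∈ W, ∀ x, u x = χ ((R + 1 : ℝ)⁻¹ • x) * f x := by
    intro R
    have hR : (R + 1 : ℝ) ≠ 0 := by positivity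
    set s : EuclideanSpace ℝ ι ≃L[ℝ] EuclideanSpace ℝ ι :=
      ContinuousLinearEquiv.smulLeft (Units.mk0 (R + 1 : ℝ) hR) with hs
    have hsx : ∀ x, s x = (R + 1 : ℝ) • x := fun _ => rfl
    have hsy : ∀ x, s.symm x = (R + 1 : ℝ)⁻¹ • x := fun x => by
      rw [s.symm_apply_eq, hsx, smul_smul, mul_inv_cancel₀ hR, one_smul]
    set S := SchwartzMap.compCLMOfContinuousLinearEquiv ℂ (F := ℂ) s.symm
    have hgrow : χ.HasTemperateGrowth := (hχ.2.toSchwartzMap hχ.1).hasTemperateGrowth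
    set v := smulLeftCLM ℂ χ (SchwartzMap.compCLMOfContinuousLinearEquiv ℂ s f)
    have hv : ∀ x, v x = χ x * f (s x) := fun x => by
      rw [smulLeftCLM_apply_apply hgrow]
      rfl
    have hmem : v ∈ W.comap (S : 𝓢(EuclideanSpace ℝ ι, ℂ) →ₗ[ℂ] 𝓢(EuclideanSpace ℝ ι, ℂ)) := by
      refine mem_of_eq_mul_bump (hW.preimage S.continuous) (fun w hw => ?_) v fun x hx => ?_
      · obtain ⟨g, hg, hw⟩ := hw
        refine hprod _ ⟨fun i t => g i ((R + 1 : ℝ)⁻¹ * t), fun i => ?_, fun x => ?_⟩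
        · refine ⟨(hg i).1.comp (contDiff_const.mul contDiff_id), ?_⟩
          exact (hg i).2.comp_homeomorph (Homeomorph.mulLeft₀ _ (inv_ne_zero hR))
        · change w (s.symm x) = _
          rw [hw, hsy]
          rfl
      · obtain ⟨i, hi⟩ := hx
        rw [hv, show χ x = 0 from Finset.prod_eq_zero (Finset.mem_univ i) (hθ0 _ hi), zero_mul]
    refine ⟨_, hmem, fun x => ?_⟩
    change v (s.symm x) = _
    rw [hv, s.apply_symm_apply, hsy]
  choose g hgW hg using hscale
  refine hW.mem_of_tendsto (SchwartzMap.tendsto_smulLeftCLM_scaled χ hχ.1 hχ.2 ?_ f g hg)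
    (Eventually.of_forall hgW)
  have : ∀ᶠ x : EuclideanSpace ℝ ι in 𝓝 0, ∀ i, |ec x i| < 1 / 8 := by
    rw [eventually_all]
    intro i
    have hc : Continuous fun x : EuclideanSpace ℝ ι => |ec x i| :=
      ((continuous_apply i).comp ec.continuous).abs
    exact hc.continuousAt.eventually_lt continuousAt_const (by simp)
  filter_upwards [this] with x hx
  exact Finset.prod_eq_one fun i _ => hθ1 _ (hx i).le

end EuclideanDensity

section Density
open Filter Topology

theorem Sch.eq_top_of_isClosed {n : ℕ} {W : Submodule ℂ (Sch n)} (hW : IsClosed (W : Set (Sch n)))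
    (hprod : ∀ (w : Sch n) (g : Fin n → Euc3 → ℂ), (∀ i, IsTest (g i)) →
      (∀ p, w p = ∏ i, g i (p i)) → w ∈ W) : W = ⊤ := by
  let l : (Fin n → Euc3) ≃ₗ[ℝ] EuclideanSpace ℝ (Fin n × Fin 3) :=
    { toFun := fun p => WithLp.toLp 2 fun ij => p ij.1 ij.2
      map_add' := fun _ _ => rfl
      map_smul' := fun _ _ => rfl
      invFun := fun x i => WithLp.toLp 2 fun j => x (i, j)
      left_inv := fun _ => rfl
      right_inv := fun _ => rfl }
  set e := l.toContinuousLinearEquiv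
  set S := SchwartzMap.compCLMOfContinuousLinearEquiv ℂ (F := ℂ) e
  have htop : W.comap (S : 𝓢(EuclideanSpace ℝ (Fin n × Fin 3), ℂ) →ₗ[ℂ] Sch n) = ⊤ := by
    refine closed_submodule_eq_top (hW.preimage S.continuous) fun w ⟨g, hg, hw⟩ => ?_
    refine hprod _ (fun i y => ∏ j, g (i, j) (EuclideanSpace.equiv (Fin 3) ℝ y j))
      (fun i => isTest_prod_coord _ _ fun j => hg (i, j)) fun p => ?_
    change w (e p) = _
    rw [hw, Fintype.prod_prod_type]
    rfl
  refine Submodule.eq_top_iff'.2 fun f => ?_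
  have : SchwartzMap.compCLMOfContinuousLinearEquiv ℂ (F := ℂ) e.symm f ∈
      W.comap (S : 𝓢(EuclideanSpace ℝ (Fin n × Fin 3), ℂ) →ₗ[ℂ] Sch n) := htop ▸ trivial
  have hf : S (SchwartzMap.compCLMOfContinuousLinearEquiv ℂ (F := ℂ) e.symm f) = f := by
    ext p
    change f (e.symm (e p)) = f p
    rw [e.symm_apply_apply]
  exact hf ▸ Submodule.mem_comap.1 this

theorem Sch.clm_ext {n m : ℕ} {T U : Sch n →L[ℂ] Sch m}
    (h : ∀ (w : Sch n) (g : Fin n → Euc3 → ℂ), (∀ i, IsTest (g i)) →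
      (∀ p, w p = ∏ i, g i (p i)) → T w = U w) : T = U := by
  have hW : IsClosed ((LinearMap.eqLocus (T : Sch n →ₗ[ℂ] Sch m) (U : Sch n →ₗ[ℂ] Sch m) :
      Submodule ℂ (Sch n)) : Set (Sch n)) := isClosed_eq T.continuous U.continuous
  have := Sch.eq_top_of_isClosed hW h
  ext1 w
  exact (this ▸ Submodule.mem_top : w ∈ LinearMap.eqLocus (T : Sch n →ₗ[ℂ] Sch m)
    (U : Sch n →ₗ[ℂ] Sch m))

theorem reindexCLM_apply {a b : ℕ} (e : Fin a ≃ Fin b) (f : Sch b) (p : Fin a → Euc3) :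
    reindexCLM e f p = f (fun j => p (e.symm j)) := by
  change f _ = f _
  congr 1
  ext1 j
  obtain ⟨i, rfl⟩ := e.surjective j
  rw [e.symm_apply_apply]
  exact Equiv.piCongrLeft_apply_apply (fun _ => Euc3) e p i

theorem Sch.exists_prod {n : ℕ} (g : Fin n → Euc3 → ℂ) (hg : ∀ i, IsTest (g i)) :
    ∃ w : Sch n, ∀ p, w p = ∏ i, g i (p i) := by
  have := isTest_prod_coord (ContinuousLinearEquiv.refl ℝ (Fin n → Euc3)) g hg
  exact ⟨this.2.toSchwartzMap this.1, fun p => rfl⟩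

end Density

section Augmentation

/-- `T` is the augmentation of `F` by the identity in the variables indexed by `κ`, when the
variables of source and target are split along `e` and `e'`. -/
def IsExt {a b n n' : ℕ} {κ : Type} [Fintype κ] (F : Sch a →L[ℂ] Sch b) (e : Fin a ⊕ κ ≃ Fin n)
    (e' : Fin b ⊕ κ ≃ Fin n') (T : Sch n →L[ℂ] Sch n') : Prop :=
  ∀ (f : Sch a) (g : κ → Euc3 → ℂ), (∀ k, IsTest (g k)) → ∀ w : Sch n,
    (∀ p, w p = f (fun i => p (e (Sum.inl i))) * ∏ k, g k (p (e (Sum.inr k)))) →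
    ∀ q, T w q = F f (fun i => q (e' (Sum.inl i))) * ∏ k, g k (q (e' (Sum.inr k)))

variable {a b c n n' n'' m : ℕ} {κ μ : Type} [Fintype κ] [Fintype μ]

theorem Sch.exists_mul_prod
    {ext : ∀ a k b : ℕ, (Sch a →L[ℂ] Sch b) → (Sch (a + k) →L[ℂ] Sch (b + k))}
    (hext : ExtRSpec ext) (e : Fin a ⊕ κ ≃ Fin n) (f : Sch a) (g : κ → Euc3 → ℂ)
    (hg : ∀ k, IsTest (g k)) :
    ∃ w : Sch n, ∀ p, w p = f (fun i => p (e (Sum.inl i))) * ∏ k, g k (p (e (Sum.inr k))) := by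
  let ν := Fintype.equivFin κ
  obtain ⟨f₀, hf₀⟩ := Sch.exists_prod (n := 0) (fun _ _ => 0) fun i => i.elim0
  obtain ⟨g₀, hg₀⟩ := Sch.exists_prod (fun j => g (ν.symm j)) fun j => hg _
  obtain ⟨w₀, hw₀⟩ := Sch.exists_prod (n := 0 + Fintype.card κ)
    (fun j => g (ν.symm (j.cast (zero_add _)))) fun j => hg _
  set δ : Sch 0 →L[ℂ] ℂ := (BoundedContinuousFunction.evalCLM ℂ 0).comp
    (SchwartzMap.toBoundedContinuousFunctionCLM ℂ (Fin 0 → Euc3) ℂ)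
  have hδ : δ f₀ = 1 := by
    change f₀ 0 = 1
    simp [hf₀]
  have key := hext 0 (Fintype.card κ) a (δ.smulRight f) f₀ g₀ w₀ fun p => by
    rw [hw₀, hf₀, hg₀, Fin.prod_univ_zero, one_mul]
    refine Fintype.prod_equiv (finCongr (zero_add _)) _ _ fun j => ?_
    congr 2
    ext
    simp
  refine ⟨reindexCLM ((e.symm.trans (Equiv.sumCongr (Equiv.refl _) ν)).trans finSumFinEquiv)
    (ext 0 (Fintype.card κ) a (δ.smulRight f) w₀), fun p => ?_⟩
  rw [reindexCLM_apply, key, ContinuousLinearMap.smulRight_apply, hδ, one_smul, hg₀]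
  congr 1
  · congr 1
    ext1 i
    congr 1
    simp [← finSumFinEquiv_apply_left]
  · refine Fintype.prod_equiv ν.symm _ _ fun j => ?_
    congr 2
    simp [← finSumFinEquiv_apply_right]

theorem IsExt.unique {F : Sch a →L[ℂ] Sch b} {e : Fin a ⊕ κ ≃ Fin n} {e' : Fin b ⊕ κ ≃ Fin n'}
    {T U : Sch n →L[ℂ] Sch n'} (hT : IsExt F e e' T) (hU : IsExt F e e' U) : T = U := by
  refine Sch.clm_ext fun w g hg hw => ?_
  obtain ⟨f, hf⟩ := Sch.exists_prod (fun i => g (e (Sum.inl i))) fun i => hg _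
  have h : ∀ p, w p = f (fun i => p (e (Sum.inl i))) *
      ∏ k, g (e (Sum.inr k)) (p (e (Sum.inr k))) := fun p => by
    rw [hw, hf, ← Fintype.prod_sum_type fun x => g (e x) (p (e x))]
    exact (Equiv.prod_comp e fun i => g i (p i)).symm
  ext q
  rw [hT f _ (fun k => hg _) w h, hU f _ (fun k => hg _) w h]

theorem IsExt.comp {F : Sch a →L[ℂ] Sch b} {G : Sch b →L[ℂ] Sch c} {e : Fin a ⊕ κ ≃ Fin n}
    {e' : Fin b ⊕ κ ≃ Fin n'} {e'' : Fin c ⊕ κ ≃ Fin n''} {T : Sch n →L[ℂ] Sch n'}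
    {U : Sch n' →L[ℂ] Sch n''} (hU : IsExt G e' e'' U) (hT : IsExt F e e' T) :
    IsExt (G.comp F) e e'' (U.comp T) :=
  fun f g hg w hw q => hU (F f) g hg (T w) (hT f g hg w hw) q

theorem IsExt.reindex_comp {F : Sch a →L[ℂ] Sch b} {e : Fin a ⊕ κ ≃ Fin n}
    {e' : Fin b ⊕ κ ≃ Fin n'} {T : Sch n →L[ℂ] Sch n'} (hT : IsExt F e e' T)
    (ρ : Fin m ≃ Fin n') : IsExt F e (e'.trans ρ.symm) ((reindexCLM ρ).comp T) := by
  intro f g hg w hw q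
  rw [ContinuousLinearMap.comp_apply, reindexCLM_apply, hT f g hg w hw]
  rfl

theorem IsExt.comp_reindex {F : Sch a →L[ℂ] Sch b} {e : Fin a ⊕ κ ≃ Fin n}
    {e' : Fin b ⊕ κ ≃ Fin n'} {T : Sch n →L[ℂ] Sch n'} (hT : IsExt F e e' T)
    (ρ : Fin n ≃ Fin m) : IsExt F (e.trans ρ) e' (T.comp (reindexCLM ρ)) := by
  intro f g hg w hw q
  refine hT f g hg _ (fun p => ?_) q
  simp [reindexCLM_apply, hw]

theorem IsExt.congr_param {F : Sch a →L[ℂ] Sch b} {e : Fin a ⊕ κ ≃ Fin n}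
    {e' : Fin b ⊕ κ ≃ Fin n'} {T : Sch n →L[ℂ] Sch n'} (hT : IsExt F e e' T) (ν : μ ≃ κ) :
    IsExt F ((Equiv.sumCongr (Equiv.refl _) ν).trans e)
      ((Equiv.sumCongr (Equiv.refl _) ν).trans e') T := by
  intro f g hg w hw q
  rw [hT f (fun k => g (ν.symm k)) (fun k => hg _) w (fun p => ?_) q]
  · congr 1
    exact Fintype.prod_equiv ν.symm _ _ fun k => by simp
  · rw [hw]
    congr 1
    exact Fintype.prod_equiv ν _ _ fun k => by simp

theorem IsExt.reindex_comp_op {F : Sch a →L[ℂ] Sch b} {e : Fin a ⊕ κ ≃ Fin n}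
    {e' : Fin b ⊕ κ ≃ Fin n'} {T : Sch n →L[ℂ] Sch n'} (hT : IsExt F e e' T)
    (τ : Fin c ≃ Fin b) :
    IsExt ((reindexCLM τ).comp F) e ((Equiv.sumCongr τ (Equiv.refl _)).trans e') T := by
  intro f g hg w hw q
  rw [hT f g hg w hw q, ContinuousLinearMap.comp_apply, reindexCLM_apply]
  simp

theorem IsExt.op_comp_reindex {F : Sch a →L[ℂ] Sch b} {e : Fin a ⊕ κ ≃ Fin n}
    {e' : Fin b ⊕ κ ≃ Fin n'} {T : Sch n →L[ℂ] Sch n'} (hT : IsExt F e e' T)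
    (τ : Fin a ≃ Fin c) :
    IsExt (F.comp (reindexCLM τ)) ((Equiv.sumCongr τ.symm (Equiv.refl _)).trans e) e' T := by
  intro f g hg w hw q
  refine hT (reindexCLM τ f) g hg w (fun p => ?_) q
  rw [hw, reindexCLM_apply]
  rfl

theorem IsExt.assoc
    {ext : ∀ a k b : ℕ, (Sch a →L[ℂ] Sch b) → (Sch (a + k) →L[ℂ] Sch (b + k))}
    (hext : ExtRSpec ext) {m' : ℕ} {F : Sch a →L[ℂ] Sch b} {e : Fin a ⊕ κ ≃ Fin n}
    {e' : Fin b ⊕ κ ≃ Fin n'} {T : Sch n →L[ℂ] Sch n'} {d : Fin n ⊕ μ ≃ Fin m}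
    {d' : Fin n' ⊕ μ ≃ Fin m'} {U : Sch m →L[ℂ] Sch m'} (hT : IsExt F e e' T)
    (hU : IsExt T d d' U) :
    IsExt F ((Equiv.sumAssoc _ κ μ).symm.trans ((Equiv.sumCongr e (Equiv.refl _)).trans d))
      ((Equiv.sumAssoc _ κ μ).symm.trans ((Equiv.sumCongr e' (Equiv.refl _)).trans d')) U := by
  intro f g hg w hw q
  obtain ⟨w₁, hw₁⟩ := Sch.exists_mul_prod hext e f (fun k => g (Sum.inl k)) fun k => hg _
  rw [hU w₁ (fun k => g (Sum.inr k)) (fun k => hg _) w fun p => ?_,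
    hT f _ (fun k => hg _) w₁ hw₁, Fintype.prod_sum_type, ← mul_assoc]
  · rfl
  · rw [hw, hw₁, Fintype.prod_sum_type, ← mul_assoc]
    rfl

theorem IsExt.smul {F : Sch a →L[ℂ] Sch b} {e : Fin a ⊕ κ ≃ Fin n}
    {e' : Fin b ⊕ κ ≃ Fin n'} {T : Sch n →L[ℂ] Sch n'} (hT : IsExt F e e' T) (z : ℂ) :
    IsExt (z • F) e e' (z • T) := by
  intro f g hg w hw q
  change z • T w q = z • F f _ * _
  rw [hT f g hg w hw q, smul_mul_assoc]

theorem IsExt.sum {α : Type*} (s : Finset α) {F : α → (Sch a →L[ℂ] Sch b)} {e : Fin a ⊕ κ ≃ Fin n}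
    {e' : Fin b ⊕ κ ≃ Fin n'} {T : α → (Sch n →L[ℂ] Sch n')}
    (hT : ∀ i, IsExt (F i) e e' (T i)) :
    IsExt (∑ i ∈ s, F i) e e' (∑ i ∈ s, T i) := by
  intro f g hg w hw q
  rw [sum_apply, sum_apply, sum_apply, sum_apply,
    Finset.sum_mul]
  exact Finset.sum_congr rfl fun i _ => hT i f g hg w hw q

theorem ExtRSpec.isExt
    {ext : ∀ a k b : ℕ, (Sch a →L[ℂ] Sch b) → (Sch (a + k) →L[ℂ] Sch (b + k))}
    (hext : ExtRSpec ext) (k : ℕ) (F : Sch a →L[ℂ] Sch b) :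
    IsExt F (finSumFinEquiv (n := k)) finSumFinEquiv (ext a k b F) := by
  intro f g hg w hw q
  obtain ⟨g₀, hg₀⟩ := Sch.exists_prod g hg
  simp only [finSumFinEquiv_apply_left, finSumFinEquiv_apply_right] at hw ⊢
  rw [hext a k b F f g₀ w (fun p => by rw [hw, hg₀]) q, hg₀]

theorem ExtLSpec.isExt
    {extL : ∀ k a b : ℕ, (Sch a →L[ℂ] Sch b) → (Sch (k + a) →L[ℂ] Sch (k + b))}
    (hextL : ExtLSpec extL) (k : ℕ) (F : Sch a →L[ℂ] Sch b) :
    IsExt F ((Equiv.sumComm _ _).trans (finSumFinEquiv (m := k)))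
      ((Equiv.sumComm _ _).trans finSumFinEquiv) (extL k a b F) := by
  intro f g hg w hw q
  obtain ⟨g₀, hg₀⟩ := Sch.exists_prod g hg
  simp only [Equiv.trans_apply, Equiv.sumComm_apply, Sum.swap_inl, Sum.swap_inr,
    finSumFinEquiv_apply_left, finSumFinEquiv_apply_right] at hw ⊢
  rw [hextL k a b F g₀ f w (fun p => by rw [hw, hg₀, mul_comm]) q, hg₀, mul_comm]

end Augmentation

section Symmetrization

variable {a b c n n' m : ℕ} {κ μ : Type}

theorem inv_factorial_smul_sum_perm {V : Type*} [AddCommGroup V] [Module ℂ V] (n : ℕ) (v : V) :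
    ((n.factorial : ℂ))⁻¹ • ∑ _σ : Equiv.Perm (Fin n), v = v := by
  rw [Finset.sum_const, Finset.card_univ, Fintype.card_perm, Fintype.card_fin,
    ← Nat.cast_smul_eq_nsmul ℂ, smul_smul, inv_mul_cancel₀ (by exact_mod_cast n.factorial_ne_zero),
    one_smul]

theorem reindexCLM_comp_reindexCLM (e : Fin a ≃ Fin b) (e' : Fin b ≃ Fin c) :
    (reindexCLM e).comp (reindexCLM e') = reindexCLM (e.trans e') := by
  ext f p
  simp [reindexCLM_apply]

theorem reindexCLM_refl : reindexCLM (Equiv.refl (Fin n)) = ContinuousLinearMap.id ℂ (Sch n) := by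
  ext f p
  simp [reindexCLM_apply]

theorem reindexCLM_comp_symCLM_self (σ : Equiv.Perm (Fin n)) :
    (reindexCLM σ).comp (SymCLM n) = SymCLM n := by
  rw [SymCLM, ContinuousLinearMap.comp_smul, ContinuousLinearMap.comp_finsetSum]
  congr 1
  exact Fintype.sum_equiv (Equiv.mulRight σ) _ _ fun τ => reindexCLM_comp_reindexCLM σ τ

theorem symCLM_comp_reindexCLM_self (σ : Equiv.Perm (Fin n)) :
    (SymCLM n).comp (reindexCLM σ) = SymCLM n := by
  rw [SymCLM, ContinuousLinearMap.smul_comp, ContinuousLinearMap.finsetSum_comp]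
  congr 1
  exact Fintype.sum_equiv (Equiv.mulLeft σ) _ _ fun τ => reindexCLM_comp_reindexCLM τ σ

theorem symCLM_apply_of_mem_DS {f : Sch n} (hf : f ∈ DS n) : SymCLM n f = f := by
  have h : ∀ σ : Equiv.Perm (Fin n), reindexCLM σ f = f := fun σ => by
    ext p
    rw [reindexCLM_apply]
    exact hf σ.symm p
  rw [SymCLM, smul_apply, sum_apply]
  simp_rw [h]
  exact inv_factorial_smul_sum_perm _ _

theorem comp_reindexCLM_of_symm {A : Sch a →L[ℂ] Sch b}
    (hA : (SymCLM b).comp (A.comp (SymCLM a)) = A) (τ : Equiv.Perm (Fin a)) :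
    A.comp (reindexCLM τ) = A := by
  conv_lhs => rw [← hA]
  rw [ContinuousLinearMap.comp_assoc, ContinuousLinearMap.comp_assoc,
    symCLM_comp_reindexCLM_self, hA]

theorem reindexCLM_comp_of_symm {A : Sch a →L[ℂ] Sch b}
    (hA : (SymCLM b).comp (A.comp (SymCLM a)) = A) (τ : Equiv.Perm (Fin b)) :
    (reindexCLM τ).comp A = A := by
  conv_lhs => rw [← hA]
  rw [← ContinuousLinearMap.comp_assoc, reindexCLM_comp_symCLM_self, hA]

/-- The positions occupied by the first summand of a splitting. -/
def inlRange (e : Fin a ⊕ κ ≃ Fin n) : Finset (Fin n) :=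
  Finset.univ.map (Function.Embedding.inl.trans e.toEmbedding)

theorem card_inlRange (e : Fin a ⊕ κ ≃ Fin n) : (inlRange e).card = a := by
  simp [inlRange]

theorem mem_inlRange {e : Fin a ⊕ κ ≃ Fin n} {j : Fin n} :
    j ∈ inlRange e ↔ ∃ i, e (Sum.inl i) = j := by
  simp [inlRange]

theorem inlRange_trans (e : Fin a ⊕ κ ≃ Fin n) (v : Fin n ≃ Fin m) :
    inlRange (e.trans v) = (inlRange e).map v.toEmbedding := by
  ext j
  simp [mem_inlRange, Equiv.eq_symm_apply]

variable [Fintype κ] [Fintype μ]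

theorem exists_sumCongr_of_inlRange_eq {e : Fin a ⊕ κ ≃ Fin n} {d : Fin a ⊕ μ ≃ Fin n}
    (h : inlRange d = inlRange e) :
    ∃ (τ : Equiv.Perm (Fin a)) (ν : μ ≃ κ), d = (Equiv.sumCongr τ ν).trans e := by
  have h1 : ∀ i, ∃ i', e (Sum.inl i') = d (Sum.inl i) := fun i =>
    mem_inlRange.1 (h ▸ mem_inlRange.2 ⟨i, rfl⟩)
  have h2 : ∀ k, ∃ k', e (Sum.inr k') = d (Sum.inr k) := fun k => by
    rcases hk : e.symm (d (Sum.inr k)) with i | k'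
    · rw [e.symm_apply_eq] at hk
      obtain ⟨i', hi'⟩ := mem_inlRange.1 (h.symm ▸ mem_inlRange.2 ⟨i, hk.symm⟩)
      exact absurd (d.injective hi') (by simp)
    · exact ⟨k', (e.symm_apply_eq.1 hk).symm⟩
  choose t ht using h1
  choose u hu using h2
  have htinj : Function.Injective t := fun i j hij => by
    have := ht i
    rw [hij, ht j] at this
    exact (Sum.inl_injective (d.injective this)).symm
  have huinj : Function.Injective u := fun i j hij => by
    have := hu i
    rw [hij, hu j] at this
    exact (Sum.inr_injective (d.injective this)).symm
  have hcard : Fintype.card μ = Fintype.card κ := by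
    have := Fintype.card_congr (d.trans e.symm)
    simpa using this
  refine ⟨Equiv.ofBijective t (Finite.injective_iff_bijective.1 htinj),
    Equiv.ofBijective u ((Fintype.bijective_iff_injective_and_card u).2 ⟨huinj, hcard⟩), ?_⟩
  ext1 x
  rcases x with i | k
  · simp [ht]
  · simp [hu]

theorem IsExt.exists_eq_comp_reindexCLM {B : Sch a →L[ℂ] Sch b}
    (hB : ∀ τ : Equiv.Perm (Fin b), (reindexCLM τ).comp B = B)
    {e : Fin a ⊕ κ ≃ Fin n} {e' : Fin b ⊕ κ ≃ Fin n'} {T : Sch n →L[ℂ] Sch n'}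
    {d : Fin a ⊕ μ ≃ Fin n} {d' : Fin b ⊕ μ ≃ Fin n'} {U : Sch n →L[ℂ] Sch n'}
    (hT : IsExt B e e' T) (hU : IsExt B d d' U) (h : inlRange d' = inlRange e') :
    ∃ ρ : Equiv.Perm (Fin n), U = T.comp (reindexCLM ρ) := by
  obtain ⟨τ, ν, hd⟩ := exists_sumCongr_of_inlRange_eq h
  have h1 := hT.reindex_comp_op τ
  rw [hB τ] at h1
  have h2 := (h1.congr_param ν).comp_reindex
    (((Equiv.sumCongr (Equiv.refl _) ν).trans e).symm.trans d)
  refine ⟨((Equiv.sumCongr (Equiv.refl _) ν).trans e).symm.trans d, hU.unique ?_⟩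
  convert h2 using 1
  · ext1 x
    simp
  · rw [hd]
    ext1 x
    rcases x with i | k <;> simp

theorem IsExt.exists_eq_reindexCLM_comp {A : Sch a →L[ℂ] Sch b}
    (hA : ∀ τ : Equiv.Perm (Fin a), A.comp (reindexCLM τ) = A)
    {e : Fin a ⊕ κ ≃ Fin n} {e' : Fin b ⊕ κ ≃ Fin n'} {T : Sch n →L[ℂ] Sch n'}
    {d : Fin a ⊕ μ ≃ Fin n} {d' : Fin b ⊕ μ ≃ Fin n'} {U : Sch n →L[ℂ] Sch n'}
    (hT : IsExt A e e' T) (hU : IsExt A d d' U) (h : inlRange d = inlRange e) :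
    ∃ ρ : Equiv.Perm (Fin n'), U = (reindexCLM ρ).comp T := by
  obtain ⟨τ, ν, hd⟩ := exists_sumCongr_of_inlRange_eq h
  have h1 := hT.op_comp_reindex τ.symm
  rw [hA] at h1
  have h2 := (h1.congr_param ν).reindex_comp
    (d'.symm.trans ((Equiv.sumCongr (Equiv.refl _) ν).trans e'))
  refine ⟨d'.symm.trans ((Equiv.sumCongr (Equiv.refl _) ν).trans e'), hU.unique ?_⟩
  convert h2 using 1
  · rw [hd]
    ext1 x
    rcases x with i | k <;> simp
  · ext1 x
    simp

theorem Finset.exists_perm_map_eq {α : Type*} [Fintype α] [DecidableEq α] {S I S' I' : Finset α}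
    (hS : S.card = S'.card) (hI : I.card = I'.card) (hSI : (S ∩ I).card = (S' ∩ I').card) :
    ∃ v : Equiv.Perm α, S.map v.toEmbedding = S' ∧ I.map v.toEmbedding = I' := by
  have hfib : ∀ c : Prop × Prop, Nonempty
      ({x // (x ∈ S, x ∈ I) = c} ≃ {x // (x ∈ S', x ∈ I') = c}) := by
    classical
    rintro ⟨c₁, c₂⟩
    refine Fintype.card_eq.1 ?_
    have hS₁ := Finset.card_sdiff_add_card_inter S I
    have hS₂ := Finset.card_sdiff_add_card_inter S' I'
    have hI₁ := Finset.card_sdiff_add_card_inter I S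
    have hI₂ := Finset.card_sdiff_add_card_inter I' S'
    rw [Finset.inter_comm] at hI₁ hI₂
    have hU₁ := Finset.card_compl_add_card (S ∪ I)
    have hU₂ := Finset.card_compl_add_card (S' ∪ I')
    have hV₁ := Finset.card_union_add_card_inter S I
    have hV₂ := Finset.card_union_add_card_inter S' I'
    rw [Fintype.card_subtype, Fintype.card_subtype]
    by_cases h₁ : c₁ <;> by_cases h₂ : c₂ <;> simp only [h₁,
      h₂, Prod.mk.injEq, eq_iff_iff, iff_true, iff_false]
    · convert hSI using 2 <;> ext <;> simp
    · have : (S \ I).card = (S' \ I').card := by omega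
      convert this using 2 <;> ext <;> simp
    · have : (I \ S).card = (I' \ S').card := by omega
      convert this using 2 <;> ext <;> simp [and_comm]
    · have : (S ∪ I)ᶜ.card = (S' ∪ I')ᶜ.card := by omega
      convert this using 2 <;> ext <;> simp
  let v : Equiv.Perm α := Equiv.ofFiberEquiv fun c => (hfib c).some
  have hv : ∀ x, ((v x ∈ S', v x ∈ I') : Prop × Prop) = (x ∈ S, x ∈ I) := fun x =>
    Equiv.ofFiberEquiv_map (g := fun x => ((x ∈ S', x ∈ I') : Prop × Prop)) _ x
  have hvS : ∀ x, v x ∈ S' ↔ x ∈ S := fun x => iff_of_eq (congrArg Prod.fst (hv x))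
  have hvI : ∀ x, v x ∈ I' ↔ x ∈ I := fun x => iff_of_eq (congrArg Prod.snd (hv x))
  refine ⟨v, ?_, ?_⟩ <;> ext y <;> obtain ⟨x, rfl⟩ := v.surjective y
  · simp [hvS]
  · simp [hvI]

theorem symCLM_comp_eq_of_card_inter_eq {aA bA aB bB L M N : ℕ} {κ μ κ' μ' : Type} [Fintype κ]
    [Fintype μ] [Fintype κ'] [Fintype μ'] {A : Sch aA →L[ℂ] Sch bA} {B : Sch aB →L[ℂ] Sch bB}
    (hA : ∀ τ : Equiv.Perm (Fin aA), A.comp (reindexCLM τ) = A)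
    (hB : ∀ τ : Equiv.Perm (Fin bB), (reindexCLM τ).comp B = B)
    {eB : Fin aB ⊕ κ ≃ Fin L} {eB' : Fin bB ⊕ κ ≃ Fin M} {TB : Sch L →L[ℂ] Sch M}
    {dB : Fin aB ⊕ κ' ≃ Fin L} {dB' : Fin bB ⊕ κ' ≃ Fin M} {UB : Sch L →L[ℂ] Sch M}
    {eA : Fin aA ⊕ μ ≃ Fin M} {eA' : Fin bA ⊕ μ ≃ Fin N} {TA : Sch M →L[ℂ] Sch N}
    {dA : Fin aA ⊕ μ' ≃ Fin M} {dA' : Fin bA ⊕ μ' ≃ Fin N} {UA : Sch M →L[ℂ] Sch N}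
    (hTB : IsExt B eB eB' TB) (hUB : IsExt B dB dB' UB)
    (hTA : IsExt A eA eA' TA) (hUA : IsExt A dA dA' UA)
    (h : (inlRange eB' ∩ inlRange eA).card = (inlRange dB' ∩ inlRange dA).card) :
    (SymCLM N).comp (TA.comp (TB.comp (SymCLM L))) =
      (SymCLM N).comp (UA.comp (UB.comp (SymCLM L))) := by
  obtain ⟨v, hvB, hvA⟩ := Finset.exists_perm_map_eq
    (by rw [card_inlRange, card_inlRange]) (by rw [card_inlRange, card_inlRange]) h
  obtain ⟨ρ, hρ⟩ := (hTB.reindex_comp v.symm).exists_eq_comp_reindexCLM hB hUB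
    (by rw [inlRange_trans]; exact hvB.symm)
  obtain ⟨ρ', hρ'⟩ := (hTA.comp_reindex v).exists_eq_reindexCLM_comp hA hUA
    (by rw [inlRange_trans]; exact hvA.symm)
  have hv : ∀ f, reindexCLM v (reindexCLM v.symm f) = f := fun f => by
    rw [← ContinuousLinearMap.comp_apply, reindexCLM_comp_reindexCLM, Equiv.self_trans_symm,
      reindexCLM_refl, ContinuousLinearMap.id_apply]
  ext1 f
  rw [hρ, hρ']
  simp only [ContinuousLinearMap.comp_apply, hv]
  have h1 := DFunLike.congr_fun (reindexCLM_comp_symCLM_self ρ) f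
  rw [ContinuousLinearMap.comp_apply] at h1
  rw [h1]
  exact (DFunLike.congr_fun (symCLM_comp_reindexCLM_self ρ') _).symm

theorem IsExt.symCLM_comp {C : Sch a →L[ℂ] Sch b} {e : Fin a ⊕ κ ≃ Fin n}
    {e' : Fin b ⊕ κ ≃ Fin n'} {T U : Sch n →L[ℂ] Sch n'} (hT : IsExt C e e' T)
    (hU : IsExt ((SymCLM b).comp C) e e' U) : (SymCLM n').comp U = (SymCLM n').comp T := by
  have h : ∀ τ : Equiv.Perm (Fin b), ∃ ρ : Equiv.Perm (Fin n'),
      IsExt ((reindexCLM τ).comp C) e e' ((reindexCLM ρ).comp T) := fun τ => by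
    refine ⟨e'.symm.trans ((Equiv.sumCongr τ (Equiv.refl _)).trans e'), ?_⟩
    convert (hT.reindex_comp_op τ).reindex_comp
      (e'.symm.trans ((Equiv.sumCongr τ (Equiv.refl _)).trans e')) using 1
    ext1 x
    simp
  choose ρ hρ using h
  have h2 := (IsExt.sum Finset.univ hρ).smul ((b.factorial : ℂ))⁻¹
  rw [← ContinuousLinearMap.finsetSum_comp, ← ContinuousLinearMap.smul_comp] at h2
  rw [hU.unique h2, ContinuousLinearMap.comp_smul, ContinuousLinearMap.comp_finsetSum]
  simp_rw [← ContinuousLinearMap.comp_assoc, symCLM_comp_reindexCLM_self]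
  exact inv_factorial_smul_sum_perm _ _

theorem IsExt.comp_symCLM {C : Sch a →L[ℂ] Sch b} {e : Fin a ⊕ κ ≃ Fin n}
    {e' : Fin b ⊕ κ ≃ Fin n'} {T U : Sch n →L[ℂ] Sch n'} (hT : IsExt C e e' T)
    (hU : IsExt (C.comp (SymCLM a)) e e' U) : U.comp (SymCLM n) = T.comp (SymCLM n) := by
  have h : ∀ τ : Equiv.Perm (Fin a), ∃ ρ : Equiv.Perm (Fin n),
      IsExt (C.comp (reindexCLM τ)) e e' (T.comp (reindexCLM ρ)) := fun τ => by
    refine ⟨((Equiv.sumCongr τ.symm (Equiv.refl _)).trans e).symm.trans e, ?_⟩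
    convert (hT.op_comp_reindex τ).comp_reindex
      (((Equiv.sumCongr τ.symm (Equiv.refl _)).trans e).symm.trans e) using 1
    ext1 x
    simp
  choose ρ hρ using h
  have h2 := (IsExt.sum Finset.univ hρ).smul ((a.factorial : ℂ))⁻¹
  rw [← ContinuousLinearMap.comp_finsetSum, ← ContinuousLinearMap.comp_smul] at h2
  rw [hU.unique h2, ContinuousLinearMap.smul_comp, ContinuousLinearMap.finsetSum_comp]
  simp_rw [ContinuousLinearMap.comp_assoc, reindexCLM_comp_symCLM_self]
  exact inv_factorial_smul_sum_perm _ _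

end Symmetrization

section Counting
open Finset

theorem Finset.card_filter_card_inter_eq {α : Type*} [Fintype α] [DecidableEq α] (S : Finset α)
    {k r : ℕ} (hr : r ≤ k) :
    #{J ∈ powersetCard k (univ : Finset α) | #(S ∩ J) = r} =
      (#S).choose r * (Fintype.card α - #S).choose (k - r) := by
  rw [← card_compl, ← card_powersetCard, ← card_powersetCard, ← card_product]
  refine card_nbij' (fun J => (S ∩ J, J \ S)) (fun X => X.1 ∪ X.2) ?_ ?_ ?_ ?_
  · intro J hJ
    simp only [coe_filter, mem_powersetCard, subset_univ, true_and, Set.mem_ofPred_eq] at hJ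
    have h := card_sdiff_add_card_inter J S
    rw [inter_comm] at h
    simp only [coe_product, Set.mem_prod, mem_coe, mem_powersetCard]
    refine ⟨⟨inter_subset_left, hJ.2⟩, fun x hx => ?_, by omega⟩
    simp_all
  · rintro ⟨X, Y⟩ h
    simp only [coe_product, Set.mem_prod, mem_coe, mem_powersetCard] at h
    obtain ⟨⟨hX, hXr⟩, hY, hYr⟩ := h
    have hdisj : Disjoint S Y := (disjoint_compl_right (a := S)).mono_right hY
    simp only [coe_filter, mem_powersetCard, subset_univ, true_and, Set.mem_ofPred_eq]
    rw [card_union_of_disjoint (hdisj.mono_left hX), inter_union_distrib_left,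
      disjoint_iff_inter_eq_empty.1 hdisj, union_empty, inter_eq_right.2 hX]
    omega
  · intro J _
    ext x
    simp
    tauto
  · rintro ⟨X, Y⟩ h
    simp only [coe_product, Set.mem_prod, mem_coe, mem_powersetCard] at h
    obtain ⟨⟨hX, -⟩, hY, -⟩ := h
    have hY' : ∀ x ∈ Y, x ∉ S := fun x hx => by simpa using hY hx
    ext x
    · have := @hX x
      have := hY' x
      simp
      tauto
    · have := @hX x
      have := hY' x
      simp
      tauto

theorem Finset.card_perm_filter_card_inter_map {α : Type*} [Fintype α] [DecidableEq α]
    (S I : Finset α) {r : ℕ} (hr : r ≤ #I) :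
    #{σ : Equiv.Perm α | #(S ∩ I.map σ.toEmbedding) = r} * (Fintype.card α).choose #I =
      (Fintype.card α).factorial * ((#S).choose r * (Fintype.card α - #S).choose (#I - r)) := by
  set c := #{σ : Equiv.Perm α | I.map σ.toEmbedding = I}
  have hc : ∀ J ∈ powersetCard #I (univ : Finset α),
      #{σ : Equiv.Perm α | I.map σ.toEmbedding = J} = c := by
    intro J hJ
    obtain ⟨v, hv, -⟩ := Finset.exists_perm_map_eq (S := J) (S' := I) (I := J) (I' := I)
      (mem_powersetCard.1 hJ).2 (mem_powersetCard.1 hJ).2 (by simpa using (mem_powersetCard.1 hJ).2)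
    refine card_equiv (Equiv.mulLeft v) fun σ => ?_
    have h : I.map ((Equiv.mulLeft v) σ).toEmbedding = (I.map σ.toEmbedding).map v.toEmbedding := by
      rw [map_map]
      rfl
    simp only [mem_filter, mem_univ, true_and]
    rw [h]
    nth_rewrite 3 [← hv]
    exact (map_injective _).eq_iff.symm
  have htot : (Fintype.card α).factorial = (Fintype.card α).choose #I * c := by
    rw [← Fintype.card_perm, ← card_univ, card_eq_sum_card_fiberwise
      (f := fun σ : Equiv.Perm α => I.map σ.toEmbedding) (t := powersetCard #I (univ : Finset α))
      fun σ _ => by simp, sum_congr rfl hc, sum_const, card_powersetCard, card_univ, smul_eq_mul]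
  have hnum : #{σ : Equiv.Perm α | #(S ∩ I.map σ.toEmbedding) = r} =
      #{J ∈ powersetCard #I (univ : Finset α) | #(S ∩ J) = r} * c := by
    rw [card_eq_sum_card_fiberwise (f := fun σ : Equiv.Perm α => I.map σ.toEmbedding)
      (t := {J ∈ powersetCard #I (univ : Finset α) | #(S ∩ J) = r}) fun σ hσ => by simpa using hσ,
      ← smul_eq_mul, ← sum_const]
    refine sum_congr rfl fun J hJ => ?_
    rw [mem_filter] at hJ
    rw [← hc J hJ.1, filter_filter]
    congr 1
    ext σ
    simp only [mem_filter, mem_univ, true_and, and_iff_right_iff_imp]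
    rintro rfl
    exact hJ.2
  rw [hnum, htot, Finset.card_filter_card_inter_eq S hr]
  ring

theorem Nat.wick_coefficient {K M a b r t c : ℕ} (hr : r ≤ a) (ha : a ≤ M)
    (ht : t + (a - r) = K)
    (hc : c * M.choose a = M.factorial * (b.choose r * K.choose (a - r))) :
    c * t.factorial = K.factorial * (M - a).factorial *
      (r.factorial * a.choose r * b.choose r) := by
  have h1 := Nat.choose_mul_factorial_mul_factorial ha
  have h2 := Nat.choose_mul_factorial_mul_factorial (show a - r ≤ K by omega)
  have h3 := Nat.choose_mul_factorial_mul_factorial hr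
  rw [show K - (a - r) = t by omega] at h2
  have hpos : 0 < M.choose a * (a - r).factorial :=
    Nat.mul_pos (Nat.choose_pos ha) (Nat.factorial_pos _)
  refine Nat.eq_of_mul_eq_mul_right hpos ?_
  calc _ = (c * M.choose a) * ((a - r).factorial * t.factorial) := by ring
    _ = M.factorial * b.choose r * (K.choose (a - r) * (a - r).factorial * t.factorial) := by
      rw [hc]; ring
    _ = (M.choose a * a.factorial * (M - a).factorial) * b.choose r * K.factorial := by rw [h2, h1]
    _ = (M.choose a * (a.choose r * r.factorial * (a - r).factorial) * (M - a).factorial) *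
        b.choose r * K.factorial := by rw [h3]
    _ = _ := by ring

end Counting

section SecondQuantization

variable {a b n n' m : ℕ} {κ : Type} [Fintype κ]

theorem IsExt.castCLM_comp {F : Sch a →L[ℂ] Sch b} {e : Fin a ⊕ κ ≃ Fin n}
    {e' : Fin b ⊕ κ ≃ Fin n'} {T : Sch n →L[ℂ] Sch n'} (hT : IsExt F e e' T) (h : n' = m) :
    IsExt F e (e'.trans (finCongr h)) ((castCLM h).comp T) :=
  hT.reindex_comp (finCongr h.symm)

theorem IsExt.comp_castCLM {F : Sch a →L[ℂ] Sch b} {e : Fin a ⊕ κ ≃ Fin n}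
    {e' : Fin b ⊕ κ ≃ Fin n'} {T : Sch n →L[ℂ] Sch n'} (hT : IsExt F e e' T) (h : m = n) :
    IsExt F (e.trans (finCongr h.symm)) e' (T.comp (castCLM h)) :=
  hT.comp_reindex (finCongr h.symm)

theorem directSum_of_castCLM (h : n = m) (f : Sch n) :
    DirectSum.of (fun M : ℕ => Sch M) m (castCLM h f) = DirectSum.of (fun M : ℕ => Sch M) n f := by
  subst h
  rw [show castCLM rfl f = f from DFunLike.congr_fun reindexCLM_refl f]

/-- The augmentation `F ⊗ id`, with the index arithmetic of source and target absorbed. -/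
def augment (ext : ∀ a k b : ℕ, (Sch a →L[ℂ] Sch b) → (Sch (a + k) →L[ℂ] Sch (b + k)))
    (k : ℕ) (F : Sch a →L[ℂ] Sch b) (h : n = a + k) (h' : b + k = n') : Sch n →L[ℂ] Sch n' :=
  (castCLM h').comp ((ext a k b F).comp (castCLM h))

theorem isExt_augment
    {ext : ∀ a k b : ℕ, (Sch a →L[ℂ] Sch b) → (Sch (a + k) →L[ℂ] Sch (b + k))}
    (hext : ExtRSpec ext) (k : ℕ) (F : Sch a →L[ℂ] Sch b) (h : n = a + k) (h' : b + k = n') :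
    IsExt F (finSumFinEquiv.trans (finCongr h.symm)) (finSumFinEquiv.trans (finCongr h'))
      (augment ext k F h h') :=
  ((hext.isExt k F).comp_castCLM h).castCLM_comp h'

theorem secondQ_of_le
    (ext : ∀ a k b : ℕ, (Sch a →L[ℂ] Sch b) → (Sch (a + k) →L[ℂ] Sch (b + k)))
    {l l' L : ℕ} (A : Sch l →L[ℂ] Sch l') (h : l ≤ L) :
    secondQ ext A L =
      (((Real.sqrt ((L.factorial : ℝ) * ((L - l + l').factorial : ℝ)) /
        ((L - l).factorial : ℝ)) : ℝ) : ℂ) • (SymCLM (L - l + l')).comp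
          (augment ext (L - l) A (by omega) (by omega)) :=
  dif_pos h

theorem exists_secondQ_contr_eq
    {ext : ∀ a k b : ℕ, (Sch a →L[ℂ] Sch b) → (Sch (a + k) →L[ℂ] Sch (b + k))}
    {extL : ∀ k a b : ℕ, (Sch a →L[ℂ] Sch b) → (Sch (k + a) →L[ℂ] Sch (k + b))}
    (hext : ExtRSpec ext) (hextL : ExtLSpec extL) {lA l'A lB l'B : ℕ}
    (A : Sch lA →L[ℂ] Sch l'A) (B : Sch lB →L[ℂ] Sch l'B) {r L M N : ℕ} (hrA : r ≤ lA)
    (hrB : r ≤ l'B) (hL : lA + lB - r ≤ L) (hM : M + lB = L + l'B) (hN : N + lA = M + l'A) :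
    ∃ (κ μ : Type) (_ : Fintype κ) (_ : Fintype μ) (dB : Fin lB ⊕ κ ≃ Fin L)
      (dB' : Fin l'B ⊕ κ ≃ Fin M) (dA : Fin lA ⊕ μ ≃ Fin M) (dA' : Fin l'A ⊕ μ ≃ Fin N)
      (UB : Sch L →L[ℂ] Sch M) (UA : Sch M →L[ℂ] Sch N),
      IsExt B dB dB' UB ∧ IsExt A dA dA' UA ∧ (inlRange dB' ∩ inlRange dA).card = r ∧
      (secondQ ext (contr ext extL A B r) L).comp (SymCLM L) =
        (((Real.sqrt ((L.factorial : ℝ) * (N.factorial : ℝ)) /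
          ((L - (lA + lB - r)).factorial : ℝ)) : ℝ) : ℂ) •
        (castCLM (show N = L - (lA + lB - r) + (l'A + l'B - r) by omega)).comp
          ((SymCLM N).comp (UA.comp (UB.comp (SymCLM L)))) := by
  obtain rfl : N = L - (lA + lB - r) + (l'A + l'B - r) := by omega
  set u := L - (lA + lB - r) with hu
  set XB : Sch (lA + lB - r) →L[ℂ] Sch (lA + (l'B - r)) :=
    (castCLM (show lA - r + l'B = lA + (l'B - r) by omega)).comp
      ((extL (lA - r) lB l'B B).comp (castCLM (show lA + lB - r = lA - r + lB by omega))) with hXB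
  set XA : Sch (lA + (l'B - r)) →L[ℂ] Sch (l'A + l'B - r) :=
    (castCLM (show l'A + (l'B - r) = l'A + l'B - r by omega)).comp (ext lA (l'B - r) l'A A) with hXA
  have hXB' := ((hextL.isExt (lA - r) B).comp_castCLM
    (show lA + lB - r = lA - r + lB by omega)).castCLM_comp
      (show lA - r + l'B = lA + (l'B - r) by omega)
  have hXA' := (hext.isExt (l'B - r) A).castCLM_comp
    (show l'A + (l'B - r) = l'A + l'B - r by omega)
  have hUB := isExt_augment hext u XB (show L = lA + lB - r + u by omega)
    (show lA + (l'B - r) + u = M by omega)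
  have hUA := isExt_augment hext u XA (show M = lA + (l'B - r) + u by omega)
    (show l'A + l'B - r + u = u + (l'A + l'B - r) by omega)
  refine ⟨_, _, _, _, _, _, _, _, _, _, hXB'.assoc hext hUB, hXA'.assoc hext hUA, ?_, ?_⟩
  · rw [← Finset.card_map Fin.valEmbedding]
    trans (Finset.Ico (lA - r) lA).card
    · congr 1
      ext x
      simp only [Finset.mem_map, Finset.mem_inter, mem_inlRange, Finset.mem_Ico,
        Fin.valEmbedding_apply, Equiv.trans_apply, Equiv.sumAssoc_symm_apply_inl,
        Equiv.sumCongr_apply, Sum.map_inl, Equiv.sumComm_apply, Sum.swap_inl,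
        finSumFinEquiv_apply_left, finSumFinEquiv_apply_right, finCongr_apply, Fin.ext_iff,
        Fin.val_cast, Fin.val_castAdd, Fin.val_natAdd]
      constructor
      · rintro ⟨y, ⟨⟨i, hi⟩, j, hj⟩, rfl⟩
        have := i.isLt
        have := j.isLt
        omega
      · intro hx
        exact ⟨⟨x, by omega⟩, ⟨⟨⟨x - (lA - r), by omega⟩, by simp; omega⟩, ⟨x, by omega⟩, rfl⟩, rfl⟩
    · rw [Nat.card_Ico]
      omega
  · have hC : contr ext extL A B r = (SymCLM (l'A + l'B - r)).comp
        ((XA.comp XB).comp (SymCLM (lA + lB - r))) := by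
      rw [contr, dif_pos ⟨hrA, hrB⟩, hXA, hXB]
      simp only [ContinuousLinearMap.comp_assoc]
    have hcast : castCLM (rfl : u + (l'A + l'B - r) = u + (l'A + l'B - r)) =
      ContinuousLinearMap.id ℂ _ := reindexCLM_refl
    rw [secondQ_of_le _ _ hL, hC, hcast, ContinuousLinearMap.id_comp, ContinuousLinearMap.smul_comp]
    congr 1
    have h1 := isExt_augment hext u ((SymCLM (l'A + l'B - r)).comp
      ((XA.comp XB).comp (SymCLM (lA + lB - r)))) (show L = lA + lB - r + u by omega)
      (show l'A + l'B - r + u = u + (l'A + l'B - r) by omega)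
    have h2 := isExt_augment hext u ((XA.comp XB).comp (SymCLM (lA + lB - r)))
      (show L = lA + lB - r + u by omega)
      (show l'A + l'B - r + u = u + (l'A + l'B - r) by omega)
    rw [h2.symCLM_comp h1, ContinuousLinearMap.comp_assoc, (hUA.comp hUB).comp_symCLM h2]
    rfl

end SecondQuantization

section Wick

theorem directSum_of_smul {n : ℕ} (z : ℂ) (f : Sch n) :
    DirectSum.of (fun M : ℕ => Sch M) n (z • f) = z • DirectSum.of (fun M : ℕ => Sch M) n f :=
  (DirectSum.lof ℂ ℕ (fun M : ℕ => Sch M) n).map_smul z f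

theorem symCLM_apply {n : ℕ} (f : Sch n) :
    SymCLM n f = ((n.factorial : ℂ))⁻¹ • ∑ σ : Equiv.Perm (Fin n), reindexCLM σ f := by
  rw [SymCLM, smul_apply, sum_apply]

theorem wick_coefficient_sqrt {K M N L a b r t c : ℕ} (hr : r ≤ a) (ha : a ≤ M)
    (ht : t + (a - r) = K)
    (hc : c * M.choose a = M.factorial * (b.choose r * K.choose (a - r))) :
    ((r.factorial * a.choose r * b.choose r : ℕ) : ℝ) *
        (Real.sqrt ((L.factorial : ℝ) * N.factorial) / t.factorial) =
      Real.sqrt ((M.factorial : ℝ) * N.factorial) / (M - a).factorial *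
        (Real.sqrt ((L.factorial : ℝ) * M.factorial) / K.factorial) * (M.factorial : ℝ)⁻¹ * c := by
  have h := congrArg (Nat.cast (R := ℝ)) (Nat.wick_coefficient hr ha ht hc)
  have hM := Real.mul_self_sqrt (Nat.cast_nonneg (α := ℝ) M.factorial)
  rw [Real.sqrt_mul (Nat.cast_nonneg _), Real.sqrt_mul (Nat.cast_nonneg _),
    Real.sqrt_mul (Nat.cast_nonneg _)]
  have := M.factorial_ne_zero
  have := K.factorial_ne_zero
  have := t.factorial_ne_zero
  have := (M - a).factorial_ne_zero
  push_cast at h ⊢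
  field_simp
  rw [pow_two, hM]
  linear_combination (-(M.factorial : ℝ)) * h

theorem card_inlRange_inter_map_le {a b n : ℕ} {κ μ : Type} (e : Fin b ⊕ κ ≃ Fin n)
    (d : Fin a ⊕ μ ≃ Fin n) (σ : Equiv.Perm (Fin n)) :
    (inlRange e ∩ (inlRange d).map σ.toEmbedding).card ≤ min a b := by
  refine le_min ?_ ?_
  · calc _ ≤ ((inlRange d).map σ.toEmbedding).card := Finset.card_le_card Finset.inter_subset_right
      _ = a := by rw [Finset.card_map, card_inlRange]
  · calc _ ≤ (inlRange e).card := Finset.card_le_card Finset.inter_subset_left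
      _ = b := card_inlRange e

theorem wick_term
    {ext : ∀ a k b : ℕ, (Sch a →L[ℂ] Sch b) → (Sch (a + k) →L[ℂ] Sch (b + k))}
    {extL : ∀ k a b : ℕ, (Sch a →L[ℂ] Sch b) → (Sch (k + a) →L[ℂ] Sch (k + b))}
    (hext : ExtRSpec ext) (hextL : ExtLSpec extL) {lA l'A lB l'B : ℕ}
    {A : Sch lA →L[ℂ] Sch l'A} {B : Sch lB →L[ℂ] Sch l'B}
    (hA : ∀ τ : Equiv.Perm (Fin lA), A.comp (reindexCLM τ) = A)
    (hB : ∀ τ : Equiv.Perm (Fin l'B), (reindexCLM τ).comp B = B)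
    {r L K M N : ℕ} (hrA : r ≤ lA) (hrB : r ≤ l'B) (hL : K + lB = L) (hM : K + l'B = M)
    (hAM : lA ≤ M) (hN : N + lA = M + l'A) {κ μ : Type} [Fintype κ] [Fintype μ]
    {eB : Fin lB ⊕ κ ≃ Fin L} {eB' : Fin l'B ⊕ κ ≃ Fin M} {eA : Fin lA ⊕ μ ≃ Fin M}
    {eA' : Fin l'A ⊕ μ ≃ Fin N} {TB : Sch L →L[ℂ] Sch M} {TA : Sch M →L[ℂ] Sch N}
    (hTB : IsExt B eB eB' TB) (hTA : IsExt A eA eA' TA) {Ψ : Sch L} (hΨ : SymCLM L Ψ = Ψ) :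
    ((r.factorial * lA.choose r * l'B.choose r : ℕ) : ℂ) •
      DirectSum.of (fun M : ℕ => Sch M) (L - (lA + lB - r) + (l'A + l'B - r))
        (secondQ ext (contr ext extL A B r) L Ψ) =
    ((Real.sqrt ((M.factorial : ℝ) * N.factorial) / (M - lA).factorial *
        (Real.sqrt ((L.factorial : ℝ) * M.factorial) / K.factorial) *
        (M.factorial : ℝ)⁻¹ : ℝ) : ℂ) •
      ∑ σ : Equiv.Perm (Fin M) with
          (inlRange eB' ∩ (inlRange eA).map σ.toEmbedding).card = r,
        DirectSum.of (fun M : ℕ => Sch M) N (SymCLM N (TA (reindexCLM σ (TB Ψ)))) := by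
  have hc := Finset.card_perm_filter_card_inter_map (inlRange eB') (inlRange eA) (r := r)
    (by rwa [card_inlRange])
  rw [card_inlRange, card_inlRange, Fintype.card_fin, show M - l'B = K by omega] at hc
  rcases lt_or_ge L (lA + lB - r) with hlt | hle
  · rw [show secondQ ext (contr ext extL A B r) L = 0 from dif_neg (by omega), zero_apply,
      map_zero, smul_zero]
    rw [Nat.choose_eq_zero_of_lt (show K < lA - r by omega), mul_zero, mul_zero,
      mul_eq_zero, or_iff_left (Nat.choose_pos hAM).ne', Finset.card_eq_zero] at hc
    rw [hc, Finset.sum_empty, smul_zero]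
  · obtain ⟨κ', μ', _, _, dB, dB', dA, dA', UB, UA, hUB, hUA, hcard, hQ⟩ :=
      exists_secondQ_contr_eq hext hextL A B hrA hrB hle (show M + lB = L + l'B by omega) hN
    have hW : ∀ σ ∈ ({σ : Equiv.Perm (Fin M) |
        (inlRange eB' ∩ (inlRange eA).map σ.toEmbedding).card = r} : Finset _),
        DirectSum.of (fun M : ℕ => Sch M) N (SymCLM N (TA (reindexCLM σ (TB Ψ)))) =
        DirectSum.of (fun M : ℕ => Sch M) N (SymCLM N (UA (UB Ψ))) := by
      intro σ hσ
      have h := symCLM_comp_eq_of_card_inter_eq hA hB hTB hUB (hTA.comp_reindex σ) hUA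
        (by rw [inlRange_trans, hcard]; exact (Finset.mem_filter.1 hσ).2)
      have h' := DFunLike.congr_fun h Ψ
      simp only [ContinuousLinearMap.comp_apply, hΨ] at h'
      rw [h']
    have hQ' := DFunLike.congr_fun hQ Ψ
    simp only [ContinuousLinearMap.comp_apply, smul_apply, hΨ] at hQ'
    rw [Finset.sum_congr rfl hW, Finset.sum_const, hQ', directSum_of_smul, directSum_of_castCLM,
      ← Nat.cast_smul_eq_nsmul ℂ, smul_smul, smul_smul]
    congr 1
    exact_mod_cast wick_coefficient_sqrt (L := L) (N := N) hrA hAM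
      (show L - (lA + lB - r) + (lA - r) = K by omega) hc

end Wick

/-- **Statement 12.** (Wick theorem for second-quantized operators.)
For symmetric continuous linear operators `A : 𝓢(ℝ^{3l_A}) → 𝓢(ℝ^{3l'_A})` and
`B : 𝓢(ℝ^{3l_B}) → 𝓢(ℝ^{3l'_B})`, every particle number `L` and every `Ψ ∈ D_S^L`,
`Â (B̂ Ψ) = ∑_{r=0}^{min(l_A, l'_B)} r! C(l_A, r) C(l'_B, r) ⬝ (A ⊗_r B)^∧ Ψ`
(the two sides are compared in the direct sum of all particle-number spaces). -/
theorem statement12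
    (ext : ∀ a k b : ℕ, (Sch a →L[ℂ] Sch b) → (Sch (a + k) →L[ℂ] Sch (b + k)))
    (extL : ∀ k a b : ℕ, (Sch a →L[ℂ] Sch b) → (Sch (k + a) →L[ℂ] Sch (k + b)))
    (hext : ExtRSpec ext) (hextL : ExtLSpec extL)
    (lA l'A lB l'B : ℕ)
    (A : Sch lA →L[ℂ] Sch l'A) (B : Sch lB →L[ℂ] Sch l'B)
    (hA : (SymCLM l'A).comp (A.comp (SymCLM lA)) = A)
    (hB : (SymCLM l'B).comp (B.comp (SymCLM lB)) = B)
    (L : ℕ) (Ψ : Sch L) (hΨ : Ψ ∈ DS L) :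
    DirectSum.of (fun M : ℕ => Sch M) (L - lB + l'B - lA + l'A)
        (secondQ ext A (L - lB + l'B) (secondQ ext B L Ψ)) =
      ∑ r ∈ Finset.range (min lA l'B + 1),
        ((r.factorial * lA.choose r * l'B.choose r : ℕ) : ℂ) •
          DirectSum.of (fun M : ℕ => Sch M) (L - (lA + lB - r) + (l'A + l'B - r))
            (secondQ ext (contr ext extL A B r) L Ψ) := by
  have hzero : ∀ r ∈ Finset.range (min lA l'B + 1), L < lA + lB - r →
      secondQ ext (contr ext extL A B r) L = 0 := fun r _ h => dif_neg (by omega)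
  by_cases hBL : lB ≤ L
  swap
  · rw [show secondQ ext B L = 0 from dif_neg hBL, zero_apply, map_zero, map_zero]
    refine (Finset.sum_eq_zero fun r hr => ?_).symm
    have := Finset.mem_range.1 hr
    rw [hzero r hr (by omega), zero_apply, map_zero, smul_zero]
  by_cases hAM : lA ≤ L - lB + l'B
  swap
  · rw [show secondQ ext A (L - lB + l'B) = 0 from dif_neg hAM, zero_apply, map_zero]
    refine (Finset.sum_eq_zero fun r hr => ?_).symm
    have := Finset.mem_range.1 hr
    rw [hzero r hr (by omega), zero_apply, map_zero, smul_zero]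
  have hTB := isExt_augment hext (L - lB) B (show L = lB + (L - lB) by omega)
    (show l'B + (L - lB) = L - lB + l'B by omega)
  have hTA := isExt_augment hext (L - lB + l'B - lA) A
    (show L - lB + l'B = lA + (L - lB + l'B - lA) by omega)
    (show l'A + (L - lB + l'B - lA) = L - lB + l'B - lA + l'A by omega)
  have hterm : ∀ r ∈ Finset.range (min lA l'B + 1), _ := fun r hr => by
    have := Finset.mem_range.1 hr
    exact wick_term hext hextL (comp_reindexCLM_of_symm hA) (reindexCLM_comp_of_symm hB)
      (show r ≤ lA by omega) (show r ≤ l'B by omega) (show L - lB + lB = L by omega) rfl hAM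
      (by omega) hTB hTA (symCLM_apply_of_mem_DS hΨ)
  rw [Finset.sum_congr rfl hterm, ← Finset.smul_sum,
    Finset.sum_fiberwise_of_maps_to (fun σ _ => ?_), secondQ_of_le ext A hAM,
    secondQ_of_le ext B hBL]
  · simp only [smul_apply, ContinuousLinearMap.comp_apply, map_smul, directSum_of_smul]
    rw [symCLM_apply (augment ext (L - lB) B _ _ Ψ)]
    simp only [map_smul, map_sum, directSum_of_smul, smul_smul]
    congr 1
    push_cast
    ring
  · exact Finset.mem_range.2 (Nat.lt_succ_of_le (card_inlRange_inter_map_le _ _ σ))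
end
end

section
/- (Canonical commutation relations for smeared creation and annihilation operators.) For g ∈ 𝓢(ℝ³) and L ∈ ℕ define a₊(g) : D_S^L → D_S^{L+1} by a₊(g)Ψ = √(L+1) · Sym_{L+1}(g ⊠ Ψ), and for f ∈ 𝓢(ℝ³) define a₋(f) : D_S^L → D_S^{L−1} for L ≥ 1 by (a₋(f)Ψ)(p₁,…,p_{L−1}) = √L · ∫_{ℝ³} f(q) Ψ(q, p₁,…,p_{L−1}) d³q, with a₋(f) = 0 on D_S^0. Then for every L ∈ ℕ and every Ψ ∈ D_S^L one has a₋(f)(a₊(g)Ψ) − a₊(g)(a₋(f)Ψ) = (∫_{ℝ³} f(q) g(q) d³q) · Ψ. -/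
noncomputable section

open SchwartzMap

/-- The smeared creation operator at particle number `M` (as a map of functions):
`a₊(g) Φ = √(M+1) ⬝ Sym_{M+1} (g ⊠ Φ)`, where
`Sym_{M+1} w (p) = (1/(M+1)!) ∑_{σ ∈ S_{M+1}} w (p ∘ σ)` and `(g ⊠ Φ)(p) = g (p 0) Φ (p ∘ succ)`. -/
noncomputable def AplusF (M : ℕ) (g : SchwartzMap Euc3 ℂ)
    (Φ : (Fin M → Euc3) → ℂ) : (Fin (M + 1) → Euc3) → ℂ :=
  fun p => ((Real.sqrt ((M : ℝ) + 1) : ℝ) : ℂ) * (((M + 1).factorial : ℂ))⁻¹ *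
    ∑ σ : Equiv.Perm (Fin (M + 1)),
      g (p (σ 0)) * Φ (fun i : Fin M => p (σ i.succ))

/-- The smeared annihilation operator, sending a function of `M + 1` block variables to a
function of `M` block variables:
`(a₋(f) Φ)(p₁, …, p_M) = √(M+1) ∫ f(q) Φ(q, p₁, …, p_M) d³q`. -/
noncomputable def AminusF (M : ℕ) (f : SchwartzMap Euc3 ℂ)
    (Φ : (Fin (M + 1) → Euc3) → ℂ) : (Fin M → Euc3) → ℂ :=
  fun p => ((Real.sqrt ((M : ℝ) + 1) : ℝ) : ℂ) * ∫ q : Euc3, f q * Φ (Fin.cons q p)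

/-- On symmetric functions, creation is a sum over the slot that receives the new particle. -/
theorem AplusF_of_symmetric {M : ℕ} (g : SchwartzMap Euc3 ℂ) {Φ : (Fin M → Euc3) → ℂ}
    (hΦ : ∀ (σ : Equiv.Perm (Fin M)) (p : Fin M → Euc3), Φ (p ∘ σ) = Φ p)
    (p : Fin (M + 1) → Euc3) :
    AplusF M g Φ p = ((Real.sqrt ((M : ℝ) + 1) : ℝ) : ℂ)⁻¹ *
      ∑ k : Fin (M + 1), g (p k) * Φ (fun i : Fin M => p (Equiv.swap 0 k i.succ)) := by
  have hsum : ∑ σ : Equiv.Perm (Fin (M + 1)),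
      g (p (σ 0)) * Φ (fun i : Fin M => p (σ i.succ)) =
      (M.factorial : ℂ) *
        ∑ k : Fin (M + 1), g (p k) * Φ (fun i : Fin M => p (Equiv.swap 0 k i.succ)) := by
    rw [← Equiv.sum_comp Equiv.Perm.decomposeFin.symm, Fintype.sum_prod_type, Finset.mul_sum]
    refine Finset.sum_congr rfl fun k _ => ?_
    have hterm (e : Equiv.Perm (Fin M)) :
        g (p (Equiv.Perm.decomposeFin.symm (k, e) 0)) *
          Φ (fun i : Fin M => p (Equiv.Perm.decomposeFin.symm (k, e) i.succ)) =
        g (p k) * Φ (fun i : Fin M => p (Equiv.swap 0 k i.succ)) := by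
      rw [Equiv.Perm.decomposeFin_symm_apply_zero,
        ← hΦ e (fun i : Fin M => p (Equiv.swap 0 k i.succ))]
      simp only [Equiv.Perm.decomposeFin_symm_apply_succ, Function.comp_def]
    rw [Finset.sum_congr rfl fun e _ => hterm e]
    simp [Fintype.card_perm]
  have hs : ((Real.sqrt ((M : ℝ) + 1) : ℝ) : ℂ) * ((Real.sqrt ((M : ℝ) + 1) : ℝ) : ℂ) =
      (M : ℂ) + 1 := by
    rw [← Complex.ofReal_mul, Real.mul_self_sqrt (by positivity)]
    push_cast
    rfl
  have hs0 : ((Real.sqrt ((M : ℝ) + 1) : ℝ) : ℂ) ≠ 0 := by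
    rw [Complex.ofReal_ne_zero]
    positivity
  have hM : (M : ℂ) + 1 ≠ 0 := Nat.cast_add_one_ne_zero M
  have hfac : (M.factorial : ℂ) ≠ 0 := Nat.cast_ne_zero.mpr M.factorial_ne_zero
  rw [AplusF, hsum, Nat.factorial_succ, ← mul_assoc]
  congr 1
  push_cast
  field_simp
  rw [sq, hs]

/-- Annihilation preserves symmetry. -/
theorem AminusF_symmetric {M : ℕ} (f : SchwartzMap Euc3 ℂ) {Φ : (Fin (M + 1) → Euc3) → ℂ}
    (hΦ : ∀ (σ : Equiv.Perm (Fin (M + 1))) (p : Fin (M + 1) → Euc3), Φ (p ∘ σ) = Φ p)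
    (σ : Equiv.Perm (Fin M)) (p : Fin M → Euc3) :
    AminusF M f Φ (p ∘ σ) = AminusF M f Φ p := by
  have h (q : Euc3) : Φ (Fin.cons q (p ∘ σ)) = Φ (Fin.cons q p) := by
    rw [← hΦ (Equiv.Perm.decomposeFin.symm (0, σ)) (Fin.cons q p)]
    congr 1
    funext i
    cases i using Fin.cases <;> simp
  simp only [AminusF, h]

theorem cons_comp_swap_succ {M : ℕ} {α : Type*} (p : Fin M → α) (j : Fin M) (q : α) :
    (fun i : Fin M => (Fin.cons q p : Fin (M + 1) → α) (Equiv.swap 0 j.succ i.succ)) =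
      Function.update p j q := by
  funext i
  by_cases hij : i = j
  · subst hij
    simp
  · rw [Equiv.swap_apply_of_ne_of_ne (Fin.succ_ne_zero i) (by simpa using hij)]
    simp [hij]

theorem cons_swap_succ_eq_update_comp {M : ℕ} {α : Type*} (p : Fin (M + 1) → α)
    (j : Fin (M + 1)) (q : α) :
    (Fin.cons q (fun i : Fin M => p (Equiv.swap 0 j i.succ)) : Fin (M + 1) → α) =
      Function.update p j q ∘ Equiv.swap 0 j := by
  funext i
  cases i using Fin.cases with
  | zero => simp
  | succ i =>
    have h : Equiv.swap 0 j i.succ ≠ j := by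
      rw [Ne, Equiv.swap_apply_eq_iff, Equiv.swap_apply_right]
      exact Fin.succ_ne_zero i
    simp [h]

theorem integrable_schwartz_mul_update {L : ℕ} (f : SchwartzMap Euc3 ℂ) (Ψ : Sch L)
    (p : Fin L → Euc3) (j : Fin L) :
    MeasureTheory.Integrable (fun q : Euc3 => f q * Ψ (Function.update p j q)) := by
  refine f.integrable.mul_bdd (c := ‖Ψ.toBoundedContinuousFunction‖) ?_ ?_
  · exact (Ψ.continuous.comp (continuous_const.update j continuous_id)).aestronglyMeasurable
  · exact .of_forall fun q => Ψ.toBoundedContinuousFunction.norm_coe_le_norm _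

theorem integrable_schwartz_mul_schwartz (f g : SchwartzMap Euc3 ℂ) :
    MeasureTheory.Integrable (fun q : Euc3 => f q * g q) :=
  f.integrable.mul_bdd (c := ‖g.toBoundedContinuousFunction‖)
    g.continuous.aestronglyMeasurable
    (.of_forall fun q => g.toBoundedContinuousFunction.norm_coe_le_norm q)

theorem AminusF_AplusF {L : ℕ} (g f : SchwartzMap Euc3 ℂ) {Ψ : Sch L} (hΨ : Ψ ∈ DS L)
    (p : Fin L → Euc3) :
    AminusF L f (AplusF L g ⇑Ψ) p = (∫ q : Euc3, f q * g q) * Ψ p +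
      ∑ j : Fin L, g (p j) * ∫ q : Euc3, f q * Ψ (Function.update p j q) := by
  have hs0 : ((Real.sqrt ((L : ℝ) + 1) : ℝ) : ℂ) ≠ 0 := by
    rw [Complex.ofReal_ne_zero]
    positivity
  have hcongr (q : Euc3) : f q * AplusF L g ⇑Ψ (Fin.cons q p) =
      ((Real.sqrt ((L : ℝ) + 1) : ℝ) : ℂ)⁻¹ * (f q * g q * Ψ p +
        ∑ j : Fin L, g (p j) * (f q * Ψ (Function.update p j q))) := by
    rw [AplusF_of_symmetric g hΨ, Fin.sum_univ_succ]
    simp only [cons_comp_swap_succ, Fin.cons_zero, Fin.cons_succ, Equiv.swap_self,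
      Equiv.refl_apply]
    rw [mul_left_comm, mul_add, Finset.mul_sum]
    simp only [mul_assoc, mul_left_comm (f q)]
  have hint (j : Fin L) := (integrable_schwartz_mul_update f Ψ p j).const_mul (g (p j))
  simp only [AminusF, hcongr]
  rw [MeasureTheory.integral_const_mul, mul_inv_cancel_left₀ hs0,
    MeasureTheory.integral_add ((integrable_schwartz_mul_schwartz f g).mul_const _)
      (MeasureTheory.integrable_finsetSum _ fun j _ => hint j),
    MeasureTheory.integral_mul_const, MeasureTheory.integral_finsetSum _ fun j _ => hint j]
  simp only [MeasureTheory.integral_const_mul]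

theorem AplusF_AminusF {M : ℕ} (g f : SchwartzMap Euc3 ℂ) {Ψ : Sch (M + 1)}
    (hΨ : Ψ ∈ DS (M + 1)) (p : Fin (M + 1) → Euc3) :
    AplusF M g (AminusF M f ⇑Ψ) p =
      ∑ j : Fin (M + 1), g (p j) * ∫ q : Euc3, f q * Ψ (Function.update p j q) := by
  have hs0 : ((Real.sqrt ((M : ℝ) + 1) : ℝ) : ℂ) ≠ 0 := by
    rw [Complex.ofReal_ne_zero]
    positivity
  rw [AplusF_of_symmetric g (AminusF_symmetric f hΨ), Finset.mul_sum]
  refine Finset.sum_congr rfl fun j _ => ?_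
  have h (q : Euc3) := hΨ (Equiv.swap 0 j) (Function.update p j q)
  simp only [AminusF, cons_swap_succ_eq_update_comp, h]
  rw [mul_left_comm, inv_mul_cancel_left₀ hs0]

/-- **Statement 14.** (Canonical commutation relations for smeared creation and
annihilation operators.)  For all `f, g ∈ 𝓢(ℝ³)`, every particle number `L` and every
`Ψ ∈ D_S^L`:
`a₋(f)(a₊(g) Ψ) - a₊(g)(a₋(f) Ψ) = (∫ f(q) g(q) d³q) ⬝ Ψ`,
where `a₋(f)` is zero on the `0`-particle space. -/
theorem statement14 (g f : SchwartzMap Euc3 ℂ) (L : ℕ) (Ψ : Sch L) (hΨ : Ψ ∈ DS L) :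
    ∀ p : Fin L → Euc3,
      AminusF L f (AplusF L g ⇑Ψ) p -
        (if h : 0 < L then
            AplusF (L - 1) g
              (AminusF (L - 1) f
                (fun p' : Fin (L - 1 + 1) → Euc3 =>
                  Ψ (fun i : Fin L => p' (Fin.cast (by omega) i))))
              (fun j : Fin (L - 1 + 1) => p (Fin.cast (by omega) j))
          else 0) =
      (∫ q : Euc3, f q * g q) * Ψ p := by
  intro p
  rw [AminusF_AplusF g f hΨ]
  cases L with
  | zero => simp
  | succ M =>
    rw [dif_pos M.succ_pos, sub_eq_iff_eq_add, add_right_inj]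
    exact (AplusF_AminusF g f hΨ p).symm
end
end

section
/- Let A be a finite set equipped with a strict partial order ≺, let τ : A → ℝ be injective and let η ∈ {−1, +1}. For a strict partial order r on A define T(r) = 1 if for all a, b ∈ A the relation a r b implies η(τ(a) − τ(b)) < 0, and T(r) = 0 otherwise. Then T(≺) = Σ over all strict linear orders ≺' on A extending ≺ of T(≺'). -/
noncomputable section

/-- The ordering indicator `T(s)` of a relation `s` on `α` with respect to the timestamps
`τ` and the sign `η`: it equals `1` if `s a b` implies `η * (τ a - τ b) < 0` for all
`a, b`, and `0` otherwise. -/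
def TInd {α : Type*} (τ : α → ℝ) (η : ℝ) (s : α → α → Prop) : ℝ :=
  @ite _ (∀ a b : α, s a b → η * (τ a - τ b) < 0) (Classical.propDecidable _) 1 0

/-- A total relation contained in an asymmetric relation is equal to it. -/
theorem eq_of_total_of_le_of_asymm {α : Type*} {s r : α → α → Prop}
    (htot : ∀ a b, a ≠ b → s a b ∨ s b a) (hasymm : ∀ a b, r a b → ¬ r b a)
    (hle : ∀ a b, s a b → r a b) : s = r := by
  ext a b
  refine ⟨hle a b, fun h => ?_⟩
  have hne : a ≠ b := by
    rintro rfl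
    exact hasymm a a h h
  exact (htot a b hne).resolve_right fun h' => hasymm a b h (hle b a h')

/-- **Statement 16.** For a strict partial order `≺` on a finite set `A`, an injective
`τ : A → ℝ` and `η = ±1`, the indicator of `≺` is the sum of the indicators of all strict
linear orders extending `≺` (the set of such extensions being finite). -/
theorem statement16 {α : Type*} [Finite α] (prec : α → α → Prop)
    (hirr : ∀ a, ¬ prec a a) (htrans : ∀ a b c, prec a b → prec b c → prec a c)
    (τ : α → ℝ) (hτ : Function.Injective τ) (η : ℝ) (hη : η = 1 ∨ η = -1) :
    ∃ hfin : {s : α → α → Prop |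
        (∀ a b, prec a b → s a b) ∧ (∀ a, ¬ s a a) ∧
        (∀ a b c, s a b → s b c → s a c) ∧
        (∀ a b, a ≠ b → s a b ∨ s b a)}.Finite,
      TInd τ η prec = ∑ s ∈ hfin.toFinset, TInd τ η s := by
  refine ⟨Set.toFinite _, ?_⟩
  have hη0 : η ≠ 0 := by rcases hη with rfl | rfl <;> norm_num
  have hasymm : ∀ a b : α, η * (τ a - τ b) < 0 → ¬ η * (τ b - τ a) < 0 := by
    intro a b h h'
    linarith
  have htot : ∀ a b : α, a ≠ b → η * (τ a - τ b) < 0 ∨ η * (τ b - τ a) < 0 := by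
    intro a b hab
    have hne : η * (τ a - τ b) ≠ 0 := mul_ne_zero hη0 (sub_ne_zero.2 (hτ.ne hab))
    rcases lt_or_gt_of_ne hne with h | h
    · exact Or.inl h
    · exact Or.inr (by linarith)
  by_cases hp : ∀ a b, prec a b → η * (τ a - τ b) < 0
  · rw [Finset.sum_eq_single (fun a b => η * (τ a - τ b) < 0)]
    · rw [TInd, TInd, if_pos hp, if_pos fun _ _ h => h]
    · intro s hs hne
      rw [Set.Finite.mem_toFinset] at hs
      exact if_neg fun h => hne (eq_of_total_of_le_of_asymm hs.2.2.2 hasymm h)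
    · intro hmem
      rw [Set.Finite.mem_toFinset] at hmem
      refine absurd ⟨hp, ?_, ?_, htot⟩ hmem
      · exact fun a h => hasymm a a h h
      · intro a b c hab hbc
        linarith
  · rw [Finset.sum_eq_zero]
    · exact if_neg hp
    · intro s hs
      rw [Set.Finite.mem_toFinset] at hs
      exact if_neg fun h => hp fun a b hab => h a b (hs.1 a b hab)
end
end

section
/- Fix v, m ∈ ℕ and g ∈ 𝓢(ℝ^{v+m+2}). Define H : ℝ^v × ℝ^m × ℝ × ℝ → ℂ by the iterated oriented integral H(τ'₁,…,τ'_v, x, t', t) = ∫_t^{t'} dτ₁ ∫_t^{τ₁} dτ₂ ⋯ ∫_t^{τ_{v−1}} dτ_v g(τ₁ − τ'₁, …, τ_v − τ'_v, x, t', t), where each ∫_a^b denotes the oriented integral (equal to minus the integral over [b,a] when b < a). Then H ∈ 𝓢(ℝ^{v+m+2}). -/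
noncomputable section

open intervalIntegral

/-- The iterated oriented integral
`simplexInt t v φ u = ∫_t^u dτ₁ ∫_t^{τ₁} dτ₂ ⋯ ∫_t^{τ_{v-1}} dτ_v  φ (τ₁, …, τ_v)`,
each `∫_a^b` being the oriented (interval) integral; for `v = 0` it is `φ` of the empty
tuple. -/
def simplexInt (t : ℝ) : (v : ℕ) → ((Fin v → ℝ) → ℂ) → ℝ → ℂ
  | 0 => fun φ _ => φ Fin.elim0
  | v + 1 => fun φ u => ∫ τ in t..u, simplexInt t v (fun rest => φ (Fin.cons τ rest)) τ

open MeasureTheory Set Filter Topology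
open scoped ContDiff NNReal ENNReal

/-- The integral of a family of smooth functions whose derivatives decay rapidly, uniformly in the
parameter, is a Schwartz function. -/
theorem exists_schwartzMap_eq_integral {S E F : Type*} [MeasurableSpace S]
    [NormedAddCommGroup E] [NormedSpace ℝ E] [NormedAddCommGroup F] [NormedSpace ℝ F]
    [CompleteSpace F] (μ : Measure S) [IsFiniteMeasure μ] (Φ : S → E → F)
    (hsmooth : ∀ s, ContDiff ℝ ∞ (Φ s))
    (hmeas : ∀ n e, AEStronglyMeasurable (fun s => iteratedFDeriv ℝ n (Φ s) e) μ)
    (hdecay : ∀ k n : ℕ, ∃ C : ℝ, ∀ᵐ s ∂μ, ∀ e, ‖e‖ ^ k * ‖iteratedFDeriv ℝ n (Φ s) e‖ ≤ C) :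
    ∃ H : SchwartzMap E F, ∀ e, H e = ∫ s, Φ s e ∂μ := by
  have hbound : ∀ n : ℕ, ∃ C : ℝ, ∀ᵐ s ∂μ, ∀ e, ‖iteratedFDeriv ℝ n (Φ s) e‖ ≤ C := by
    intro n
    simpa using hdecay 0 n
  have hint : ∀ n e, Integrable (fun s => iteratedFDeriv ℝ n (Φ s) e) μ := by
    intro n e
    obtain ⟨C, hC⟩ := hbound n
    exact Integrable.of_bound (hmeas n e) C (hC.mono fun s hs => hs e)
  have hderiv : ∀ n e, HasFDerivAt (fun e => ∫ s, iteratedFDeriv ℝ n (Φ s) e ∂μ)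
      (∫ s, iteratedFDeriv ℝ (n + 1) (Φ s) e ∂μ).curryLeft e := by
    intro n e
    obtain ⟨C, hC⟩ := hbound (n + 1)
    let K : (E [×(n + 1)]→L[ℝ] F) →L[ℝ] E →L[ℝ] E [×n]→L[ℝ] F :=
      (continuousMultilinearCurryLeftEquiv ℝ (fun _ : Fin (n + 1) => E)
        F).toContinuousLinearEquiv.toContinuousLinearMap
    have hcurry : ∫ s, K (iteratedFDeriv ℝ (n + 1) (Φ s) e) ∂μ =
        K (∫ s, iteratedFDeriv ℝ (n + 1) (Φ s) e ∂μ) :=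
      ContinuousLinearMap.integral_comp_comm (𝕜 := ℝ) (Fₗ := E →L[ℝ] E [×n]→L[ℝ] F) K
        (hint (n + 1) e)
    change HasFDerivAt _ (K _) e
    rw [← hcurry]
    refine hasFDerivAt_integral_of_dominated_of_fderiv_le (bound := fun _ => C)
      (F' := fun e s => (continuousMultilinearCurryLeftEquiv ℝ (fun _ : Fin (n + 1) => E) F)
        (iteratedFDeriv ℝ (n + 1) (Φ s) e)) univ_mem
      (Eventually.of_forall (hmeas n)) (hint n e) ?_ ?_ (integrable_const C) ?_
    · exact (LinearIsometryEquiv.continuous _).comp_aestronglyMeasurable (hmeas (n + 1) e)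
    · filter_upwards [hC] with s hs e _
      exact (LinearIsometryEquiv.norm_map _ _).trans_le (hs e)
    · refine Eventually.of_forall fun s e _ => ?_
      have hd : DifferentiableAt ℝ (iteratedFDeriv ℝ n (Φ s)) e :=
        ((hsmooth s).differentiable_iteratedFDeriv (m := n)
          (mod_cast ENat.natCast_lt_top n)).differentiableAt
      exact hd.hasFDerivAt
  let P : E → FormalMultilinearSeries ℝ E F := fun e n => ∫ s, iteratedFDeriv ℝ n (Φ s) e ∂μ
  have htaylor : HasFTaylorSeriesUpTo ∞ (fun e => ∫ s, Φ s e ∂μ) P := by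
    refine ⟨fun e => ?_, fun n _ e => hderiv n e, fun n _ =>
      continuous_iff_continuousAt.2 fun e => (hderiv n e).continuousAt⟩
    have hcurry := (continuousMultilinearCurryFin0 ℝ E F).toContinuousLinearEquiv.integral_comp_comm
      (μ := μ) (fun s => iteratedFDeriv ℝ 0 (Φ s) e)
    change (continuousMultilinearCurryFin0 ℝ E F).toContinuousLinearEquiv _ = _
    rw [← hcurry]
    simp
  refine ⟨⟨fun e => ∫ s, Φ s e ∂μ, htaylor.contDiff, fun k n => ?_⟩, fun e => rfl⟩
  obtain ⟨C, hC⟩ := hdecay k n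
  refine ⟨C * μ.real univ, fun e => ?_⟩
  rw [← htaylor.eq_iteratedFDeriv (mod_cast le_top) e]
  have h := norm_integral_le_of_norm_le_const (μ := μ) (C := C)
    (f := fun s => ‖e‖ ^ k • iteratedFDeriv ℝ n (Φ s) e) (hC.mono fun s hs => by
      simpa [norm_smul] using hs e)
  rwa [MeasureTheory.integral_smul, norm_smul, norm_pow, norm_norm] at h

theorem continuous_iteratedFDeriv_comp_clm {S E E' F : Type*} [TopologicalSpace S]
    [NormedAddCommGroup E] [NormedSpace ℝ E] [NormedAddCommGroup E'] [NormedSpace ℝ E']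
    [NormedAddCommGroup F] [NormedSpace ℝ F] {f : E' → F} (hf : ContDiff ℝ ∞ f)
    {A : S → E →L[ℝ] E'} (hA : Continuous A) (n : ℕ) (e : E) :
    Continuous fun s => iteratedFDeriv ℝ n (f ∘ A s) e := by
  have h : ∀ s, iteratedFDeriv ℝ n (f ∘ A s) e =
      ContinuousMultilinearMap.compContinuousLinearMapContinuousMultilinear ℝ
        (fun _ : Fin n => E) (fun _ : Fin n => E') F (fun _ => A s)
          (iteratedFDeriv ℝ n f (A s e)) := fun s =>
    (A s).iteratedFDeriv_comp_right hf e (mod_cast le_top)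
  simp_rw [h]
  refine Continuous.clm_apply ?_ ?_
  · exact (ContinuousMultilinearMap.cont _).comp (continuous_pi fun _ => hA)
  · exact (hf.continuous_iteratedFDeriv (m := n) (mod_cast le_top)).comp
      (hA.clm_apply continuous_const)

/-- Averaging a Schwartz function over a family of linear maps, bounded and uniformly bounded below,
yields a Schwartz function. -/
theorem SchwartzMap.exists_eq_integral_comp_clm {S E E' F : Type*} [TopologicalSpace S]
    [MeasurableSpace S] [OpensMeasurableSpace S] [SecondCountableTopology S]
    [NormedAddCommGroup E] [NormedSpace ℝ E] [NormedAddCommGroup E'] [NormedSpace ℝ E']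
    [NormedAddCommGroup F] [NormedSpace ℝ F] [CompleteSpace F]
    (μ : Measure S) [IsFiniteMeasure μ] (g : SchwartzMap E' F) {A : S → E →L[ℝ] E'}
    (hA : Continuous A) {B C : ℝ} (hB : ∀ᵐ s ∂μ, ‖A s‖ ≤ B)
    (hC : ∀ᵐ s ∂μ, ∀ e, ‖e‖ ≤ C * ‖A s e‖) :
    ∃ H : SchwartzMap E F, ∀ e, H e = ∫ s, g (A s e) ∂μ := by
  have hg : ContDiff ℝ ∞ g := g.smooth'
  refine exists_schwartzMap_eq_integral μ (fun s => g ∘ A s)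
    (fun s => hg.comp (A s).contDiff)
    (fun n e => (continuous_iteratedFDeriv_comp_clm hg hA n e).aestronglyMeasurable)
    fun k n => ?_
  obtain ⟨D, hD⟩ := g.decay' k n
  refine ⟨|C| ^ k * D * |B| ^ n, ?_⟩
  filter_upwards [hB, hC] with s hBs hCs e
  rw [(A s).iteratedFDeriv_comp_right hg e (mod_cast le_top)]
  have h1 : ‖e‖ ^ k ≤ |C| ^ k * ‖A s e‖ ^ k := by
    rw [← mul_pow]
    gcongr
    exact (hCs e).trans (by gcongr; exact le_abs_self C)
  have h2 : ‖(iteratedFDeriv ℝ n g (A s e)).compContinuousLinearMap fun _ => A s‖ ≤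
      ‖iteratedFDeriv ℝ n g (A s e)‖ * |B| ^ n := by
    refine (ContinuousMultilinearMap.norm_compContinuousLinearMap_le _ _).trans ?_
    simp only [Finset.prod_const, Finset.card_univ, Fintype.card_fin]
    gcongr
    exact hBs.trans (le_abs_self B)
  calc ‖e‖ ^ k * ‖(iteratedFDeriv ℝ n g (A s e)).compContinuousLinearMap fun _ => A s‖
      ≤ (|C| ^ k * ‖A s e‖ ^ k) * (‖iteratedFDeriv ℝ n g (A s e)‖ * |B| ^ n) := by gcongr
    _ = |C| ^ k * (‖A s e‖ ^ k * ‖iteratedFDeriv ℝ n g (A s e)‖) * |B| ^ n := by ring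
    _ ≤ |C| ^ k * D * |B| ^ n := by
      gcongr
      exact hD (A s e)

/-- The iterated integral is a rescaled integral against a fixed finite measure on the cube. -/
theorem exists_measure_simplexInt_eq (v : ℕ) :
    ∃ μ : Measure (Fin v → ℝ), IsFiniteMeasure μ ∧ (∀ᵐ p ∂μ, p ∈ Icc (0 : Fin v → ℝ) 1) ∧
      ∀ (t u : ℝ) (φ : (Fin v → ℝ) → ℂ), Continuous φ →
        simplexInt t v φ u = (u - t) ^ v • ∫ p, φ (fun i => t + (u - t) * p i) ∂μ := by
  induction v with
  | zero =>
    refine ⟨Measure.dirac 0, inferInstance, ?_, fun t u φ _ => ?_⟩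
    · rw [ae_dirac_eq]
      simp
    · simp only [simplexInt, pow_zero, one_smul, integral_dirac]
      congr 1
      exact Subsingleton.elim _ _
  | succ v ih =>
    obtain ⟨μ, hfin, hcube, hμ⟩ := ih
    let ν : Measure ℝ := (volume.restrict (Ioc 0 1)).withDensity
      fun s => ((Real.toNNReal s ^ v : ℝ≥0) : ℝ≥0∞)
    have hνac : ν ≪ volume.restrict (Ioc 0 1) := withDensity_absolutelyContinuous _ _
    have hνmem : ∀ᵐ s ∂ν, s ∈ Ioc (0 : ℝ) 1 := hνac.ae_le (ae_restrict_mem measurableSet_Ioc)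
    have hνfin : IsFiniteMeasure ν := by
      refine isFiniteMeasure_withDensity ?_
      refine ((setLIntegral_mono measurable_const (g := fun _ => (1 : ℝ≥0∞))
        fun s hs => ?_).trans_lt (by simp)).ne
      have : Real.toNNReal s ^ v ≤ 1 := pow_le_one₀ (by simp) (by simpa using hs.2)
      exact_mod_cast this
    let T : ℝ × (Fin v → ℝ) → Fin (v + 1) → ℝ := fun q => Fin.cons q.1 (q.1 • q.2)
    have hT : Continuous T := by
      refine continuous_pi fun i => ?_
      refine Fin.cases ?_ (fun j => ?_) i
      · exact continuous_fst
      · simp only [T, Fin.cons_succ, Pi.smul_apply, smul_eq_mul]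
        fun_prop
    have hcube' : ∀ᵐ q ∂ν.prod μ, q.1 ∈ Ioc (0 : ℝ) 1 ∧ q.2 ∈ Icc (0 : Fin v → ℝ) 1 :=
      (Measure.quasiMeasurePreserving_fst.ae hνmem).and
        (Measure.quasiMeasurePreserving_snd.ae hcube)
    have hTcube : ∀ᵐ q ∂ν.prod μ, T q ∈ Icc (0 : Fin (v + 1) → ℝ) 1 := by
      filter_upwards [hcube'] with q hq
      refine ⟨fun i => ?_, fun i => ?_⟩ <;> refine Fin.cases ?_ (fun j => ?_) i
      · exact hq.1.1.le
      · exact mul_nonneg hq.1.1.le (hq.2.1 j)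
      · exact hq.1.2
      · exact mul_le_one₀ hq.1.2 (hq.2.1 j) (hq.2.2 j)
    refine ⟨(ν.prod μ).map T, inferInstance, ?_, fun t u φ hφ => ?_⟩
    · exact (ae_map_iff hT.aemeasurable measurableSet_Icc).2 hTcube
    · have hψ : Continuous fun p : Fin (v + 1) → ℝ => φ (fun i => t + (u - t) * p i) := by
        fun_prop
      have hint : Integrable (fun q => φ (fun i => t + (u - t) * T q i)) (ν.prod μ) := by
        obtain ⟨C, hC⟩ := isCompact_Icc.exists_bound_of_continuousOn
          (hψ.continuousOn (s := Icc (0 : Fin (v + 1) → ℝ) 1))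
        exact Integrable.of_bound (hψ.comp hT).aestronglyMeasurable C
          (hTcube.mono fun q hq => hC _ hq)
      rw [integral_map hT.aemeasurable hψ.aestronglyMeasurable, integral_prod _ hint,
        integral_withDensity_eq_integral_smul (by fun_prop), ← integral_of_le zero_le_one]
      have hsub := smul_integral_comp_add_mul (a := 0) (b := 1)
        (fun τ => simplexInt t v (fun rest => φ (Fin.cons τ rest)) τ) (u - t) t
      simp only [mul_zero, add_zero, mul_one, add_sub_cancel] at hsub
      refine hsub.symm.trans ?_
      rw [pow_succ', mul_smul, ← intervalIntegral.integral_smul ((u - t) ^ v)]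
      refine congrArg (fun z : ℂ => (u - t) • z) (intervalIntegral.integral_congr fun s hs => ?_)
      rw [uIcc_of_le zero_le_one] at hs
      have hcons : Continuous fun rest : Fin v → ℝ => φ (Fin.cons (t + (u - t) * s) rest) := by
        refine hφ.comp (continuous_pi fun i => ?_)
        refine Fin.cases ?_ (fun j => ?_) i
        · exact continuous_const
        · exact continuous_apply j
      rw [hμ _ _ _ hcons, NNReal.smul_def, smul_smul, add_sub_cancel_left, mul_pow]
      simp only [NNReal.coe_pow, Real.coe_toNNReal s hs.1]
      congr 1
      refine integral_congr_ae (Eventually.of_forall fun p => ?_)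
      simp only
      congr 1
      ext i
      refine Fin.cases ?_ (fun j => ?_) i
      · simp [T]
      · simp [T, mul_assoc]

/-- The linear map `(τ', x, t', t) ↦ (t + (t' - t) p - τ', x, t', t)`. -/
def shearCLM (v m : ℕ) (p : Fin v → ℝ) :
    ((Fin v → ℝ) × Euc m × ℝ × ℝ) →L[ℝ] ((Fin v → ℝ) × Euc m × ℝ × ℝ) :=
  let π₁ := ContinuousLinearMap.fst ℝ (Fin v → ℝ) (Euc m × ℝ × ℝ)
  let π₂ := ContinuousLinearMap.snd ℝ (Fin v → ℝ) (Euc m × ℝ × ℝ)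
  let t' := ContinuousLinearMap.fst ℝ ℝ ℝ ∘L ContinuousLinearMap.snd ℝ (Euc m) (ℝ × ℝ) ∘L π₂
  let t := ContinuousLinearMap.snd ℝ ℝ ℝ ∘L ContinuousLinearMap.snd ℝ (Euc m) (ℝ × ℝ) ∘L π₂
  (t.smulRight (1 : Fin v → ℝ) + (t' - t).smulRight p - π₁).prod π₂

theorem shearCLM_apply {v m : ℕ} (p τ' : Fin v → ℝ) (x : Euc m) (t' t : ℝ) :
    shearCLM v m p (τ', x, t', t) = (fun i => t + (t' - t) * p i - τ' i, x, t', t) := by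
  simp only [shearCLM, ContinuousLinearMap.prod_apply]
  refine Prod.ext ?_ rfl
  ext i
  simp

theorem continuous_shearCLM (v m : ℕ) : Continuous (shearCLM v m) := by
  have h : ∀ p, shearCLM v m p = shearCLM v m 0 +
      ContinuousLinearMap.inl ℝ (Fin v → ℝ) (Euc m × ℝ × ℝ) ∘L
        ContinuousLinearMap.smulRightL ℝ _ _
          ((ContinuousLinearMap.fst ℝ ℝ ℝ - ContinuousLinearMap.snd ℝ ℝ ℝ) ∘L
            ContinuousLinearMap.snd ℝ (Euc m) (ℝ × ℝ) ∘L
              ContinuousLinearMap.snd ℝ (Fin v → ℝ) (Euc m × ℝ × ℝ)) p := by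
    intro p
    refine ContinuousLinearMap.ext fun ⟨τ', x, t', t⟩ => ?_
    rw [add_apply, shearCLM_apply, shearCLM_apply]
    refine Prod.ext ?_ (by simp)
    ext i
    simp
    ring
  rw [funext h]
  fun_prop

theorem norm_le_norm_shearCLM {v m : ℕ} {p : Fin v → ℝ} (hp : p ∈ Icc (0 : Fin v → ℝ) 1)
    (e : (Fin v → ℝ) × Euc m × ℝ × ℝ) : ‖e‖ ≤ 4 * ‖shearCLM v m p e‖ := by
  obtain ⟨τ', x, t', t⟩ := e
  rw [shearCLM_apply]
  set w : Fin v → ℝ := fun i => t + (t' - t) * p i - τ' i with hw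
  set N := ‖(w, x, t', t)‖ with hN
  have hN0 : 0 ≤ N := norm_nonneg _
  have h2 : ‖(x, t', t)‖ ≤ N := norm_snd_le (w, x, t', t)
  have h3 : ‖(t', t)‖ ≤ N := (norm_snd_le (x, t', t)).trans h2
  have ht' : |t'| ≤ N := (norm_fst_le (t', t)).trans h3
  have ht : |t| ≤ N := (norm_snd_le (t', t)).trans h3
  have hτ : ‖τ'‖ ≤ 4 * N := by
    refine (pi_norm_le_iff_of_nonneg (by positivity)).2 fun i => ?_
    have hwi : |t + (t' - t) * p i - τ' i| ≤ N :=
      (norm_le_pi_norm w i).trans (norm_fst_le (w, x, t', t))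
    have hpi : |(t' - t) * p i| ≤ 2 * N := by
      rw [abs_mul, abs_of_nonneg (hp.1 i)]
      have := abs_sub t' t
      have := mul_le_of_le_one_right (abs_nonneg (t' - t)) (hp.2 i)
      linarith
    rw [Real.norm_eq_abs, abs_le]
    rw [abs_le] at hwi hpi ht
    constructor <;> linarith
  exact max_le hτ (h2.trans (by linarith))

/-- **Statement 17.** For `g ∈ 𝓢(ℝ^{v+m+2})`, the function
`H (τ', x, t', t) = ∫_t^{t'} dτ₁ ∫_t^{τ₁} dτ₂ ⋯ ∫_t^{τ_{v-1}} dτ_v g (τ - τ', x, t', t)`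
is again a Schwartz function. -/
theorem statement17 (v m : ℕ) (g : SchwartzMap ((Fin v → ℝ) × Euc m × ℝ × ℝ) ℂ) :
    ∃ H : SchwartzMap ((Fin v → ℝ) × Euc m × ℝ × ℝ) ℂ,
      ∀ (τ' : Fin v → ℝ) (x : Euc m) (t' t : ℝ),
        H (τ', x, t', t) =
          simplexInt t v (fun τ : Fin v → ℝ => g (fun i => τ i - τ' i, x, t', t)) t' := by
  obtain ⟨μ, _, hcube, hμ⟩ := exists_measure_simplexInt_eq v
  obtain ⟨B, hB⟩ := isCompact_Icc.exists_bound_of_continuousOn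
    ((continuous_shearCLM v m).continuousOn (s := Icc (0 : Fin v → ℝ) 1))
  obtain ⟨H, hH⟩ := g.exists_eq_integral_comp_clm μ (continuous_shearCLM v m)
    (hcube.mono hB) (hcube.mono fun p hp => norm_le_norm_shearCLM hp)
  let L : ((Fin v → ℝ) × Euc m × ℝ × ℝ) →L[ℝ] ℝ :=
    (ContinuousLinearMap.fst ℝ ℝ ℝ - ContinuousLinearMap.snd ℝ ℝ ℝ) ∘L
      ContinuousLinearMap.snd ℝ (Euc m) (ℝ × ℝ) ∘L
        ContinuousLinearMap.snd ℝ (Fin v → ℝ) (Euc m × ℝ × ℝ)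
  have hL : (fun e => L e ^ v).HasTemperateGrowth := L.hasTemperateGrowth.pow v
  refine ⟨SchwartzMap.smulLeftCLM ℂ (fun e => L e ^ v) H, fun τ' x t' t => ?_⟩
  rw [SchwartzMap.smulLeftCLM_apply_apply hL, hH,
    hμ t t' (fun τ => g (fun i => τ i - τ' i, x, t', t)) (g.continuous.comp (by fun_prop))]
  simp only [shearCLM_apply]
  rfl
end
end
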